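/- Let n ≥ 1, −1 < γ < ∞, 1 < p < ∞, and f ∈ C(Q₁) ∩ L^∞(Q₁). Let u be a bounded viscosity solution of ∂_t u − |Du|^γ Δ_p^N u = f in Q₁. Then there exists a constant C = C(p,n,γ) > 0 such that for all (x,t),(y,t) ∈ Q_{7/8} one has |u(x,t) − u(y,t)| ≤ C(‖u‖_{L^∞(Q₁)} + ‖u‖_{L^∞(Q₁)}^{1/(1+γ)} + ‖f‖_{L^∞(Q₁)}^{1/(1+γ)}) |x−y|. -/

import Mathlib

open Set Real RealInnerProductSpace

noncomputable section

/-- `ℝⁿ` with the Euclidean structure. -/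
abbrev En (n : ℕ) : Type := EuclideanSpace ℝ (Fin n)

/-- The parabolic cylinder `Q_r := B_r(0) × (-r², 0) ⊂ ℝⁿ × ℝ`. -/
def pCyl (n : ℕ) (r : ℝ) : Set (En n × ℝ) :=
  {z | ‖z.1‖ < r ∧ z.2 ∈ Set.Ioo (-r ^ 2) (0 : ℝ)}

/-- The intrinsic cylinder `Q_r^a := B_r(0) × (-r² a^{-γ}, 0)`. -/
def iCyl (n : ℕ) (γ r a : ℝ) : Set (En n × ℝ) :=
  {z | ‖z.1‖ < r ∧ z.2 ∈ Set.Ioo (-(r ^ 2 * a ^ (-γ))) (0 : ℝ)}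

/-- Spatial gradient of a function of space and time. -/
def sGrad {n : ℕ} (φ : En n × ℝ → ℝ) (x : En n) (t : ℝ) : En n :=
  gradient (fun y => φ (y, t)) x

/-- Spatial Hessian of a function of space and time. -/
def sHess {n : ℕ} (φ : En n × ℝ → ℝ) (x : En n) (t : ℝ) : En n →L[ℝ] En n :=
  fderiv ℝ (fun y => sGrad φ y t) x

/-- The value `|q|^γ (tr H + (p-2) ⟨H q, q⟩ / |q|²)`, i.e. `|q|^γ` times the normalized
`p`-Laplacian computed from a gradient `q ≠ 0` and a Hessian `H`. -/
def opVal {n : ℕ} (γ p : ℝ) (q : En n) (H : En n →L[ℝ] En n) : ℝ :=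
  ‖q‖ ^ γ * (LinearMap.trace ℝ (En n) H.toLinearMap + (p - 2) * ⟪H q, q⟫ / ‖q‖ ^ 2)

/-- Viscosity supersolution of `∂ₜ u - |Du|^γ Δ_p^N u = f` on `Ω`. -/
def IsSupersol {n : ℕ} (γ p : ℝ) (f u : En n × ℝ → ℝ) (Ω : Set (En n × ℝ)) : Prop :=
  (∀ z ∈ Ω, ∀ φ : En n × ℝ → ℝ, ContDiff ℝ 2 φ →
      sGrad φ z.1 z.2 ≠ 0 → φ z = u z → (∀ w ∈ Ω, φ w ≤ u w) →
      f z ≤ deriv (fun s => φ (z.1, s)) z.2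
            - opVal γ p (sGrad φ z.1 z.2) (sHess φ z.1 z.2)) ∧
  (∀ z ∈ Ω, ∀ δ : ℝ, 0 < δ → ∀ φ : ℝ → ℝ,
      ContDiffOn ℝ 1 φ (Set.Ioo (z.2 - δ) (z.2 + δ)) → φ z.2 = 0 →
      (∀ t ∈ Set.Ioo (z.2 - δ) (z.2 + δ), u (z.1, z.2) ≤ u (z.1, t) - φ t) →
      (∃ ε > (0:ℝ), ∃ c : ℝ, ∀ x : En n, ‖x - z.1‖ < ε →
          sInf ((fun t => u (x, t) - φ t) '' Set.Ioo (z.2 - δ) (z.2 + δ)) = c) →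
      f z ≤ deriv φ z.2)

/-- Viscosity subsolution of `∂ₜ u - |Du|^γ Δ_p^N u = f` on `Ω`. -/
def IsSubsol {n : ℕ} (γ p : ℝ) (f u : En n × ℝ → ℝ) (Ω : Set (En n × ℝ)) : Prop :=
  (∀ z ∈ Ω, ∀ φ : En n × ℝ → ℝ, ContDiff ℝ 2 φ →
      sGrad φ z.1 z.2 ≠ 0 → φ z = u z → (∀ w ∈ Ω, u w ≤ φ w) →
      deriv (fun s => φ (z.1, s)) z.2
            - opVal γ p (sGrad φ z.1 z.2) (sHess φ z.1 z.2) ≤ f z) ∧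
  (∀ z ∈ Ω, ∀ δ : ℝ, 0 < δ → ∀ φ : ℝ → ℝ,
      ContDiffOn ℝ 1 φ (Set.Ioo (z.2 - δ) (z.2 + δ)) → φ z.2 = 0 →
      (∀ t ∈ Set.Ioo (z.2 - δ) (z.2 + δ), u (z.1, t) - φ t ≤ u (z.1, z.2)) →
      (∃ ε > (0:ℝ), ∃ c : ℝ, ∀ x : En n, ‖x - z.1‖ < ε →
          sSup ((fun t => u (x, t) - φ t) '' Set.Ioo (z.2 - δ) (z.2 + δ)) = c) →
      deriv φ z.2 ≤ f z)

/-- Viscosity solution of `∂ₜ u - |Du|^γ Δ_p^N u = f` on `Ω`: a continuous function which is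
both a viscosity supersolution and a viscosity subsolution. -/
def IsViscSol {n : ℕ} (γ p : ℝ) (f u : En n × ℝ → ℝ) (Ω : Set (En n × ℝ)) : Prop :=
  ContinuousOn u Ω ∧ IsSupersol γ p f u Ω ∧ IsSubsol γ p f u Ω

/-- Viscosity solution of the deviation equation
`∂ₜ w - |Dw+K|^γ [Δw + (p-2)⟨D²w (Dw+K), Dw+K⟩/|Dw+K|²] = f` on `Ω`; equivalently,
`u(x,t) := w(x,t) + K·x` is a viscosity solution of `∂ₜ u - |Du|^γ Δ_p^N u = f`. -/
def IsDevSol {n : ℕ} (γ p : ℝ) (K : En n) (f w : En n × ℝ → ℝ) (Ω : Set (En n × ℝ)) : Prop :=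
  IsViscSol γ p f (fun z => w z + ⟪K, z.1⟫) Ω

set_option linter.unusedSectionVars false

section Reg
variable {E : Type*} [NormedAddCommGroup E] [InnerProductSpace ℝ E] [FiniteDimensional ℝ E]

/-- sup-convolution -/
def supc (δ : ℝ) (a : E → ℝ) (z : E) : ℝ := ⨆ w, (a w - ‖z - w‖ ^ 2 / (2 * δ))

/-- inf-convolution -/
def infc (δ : ℝ) (a : E → ℝ) (z : E) : ℝ := - supc δ (fun w => - a w) z

lemma le_supc {δ B : ℝ} (hδ : 0 < δ) {a : E → ℝ} (hB : ∀ z, |a z| ≤ B) (z w : E) :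
    a w - ‖z - w‖ ^ 2 / (2 * δ) ≤ supc δ a z := by
  refine le_ciSup (f := fun w => a w - ‖z - w‖ ^ 2 / (2 * δ)) ?_ w
  refine ⟨B, ?_⟩
  rintro _ ⟨w, rfl⟩
  have h1 := (abs_le.1 (hB w)).2
  have : 0 ≤ ‖z - w‖ ^ 2 / (2 * δ) := by positivity
  simp only
  linarith

lemma exists_supc {δ B : ℝ} (hδ : 0 < δ) {a : E → ℝ} (ha : Continuous a)
    (hB : ∀ z, |a z| ≤ B) (z : E) :
    ∃ w, supc δ a z = a w - ‖z - w‖ ^ 2 / (2 * δ) ∧ ‖z - w‖ ^ 2 ≤ 4 * δ * B := by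
  have hcl : IsCompact {w : E | ‖z - w‖ ^ 2 ≤ 4 * δ * B} := by
    have : {w : E | ‖z - w‖ ^ 2 ≤ 4 * δ * B} ⊆ Metric.closedBall z (4 * δ * B + 1) := by
      intro w hw
      simp only [mem_ofPred_eq] at hw
      rw [Metric.mem_closedBall, dist_comm, dist_eq_norm]
      nlinarith [norm_nonneg (z - w), sq_nonneg (‖z - w‖ - 1)]
    refine (isCompact_closedBall z (4 * δ * B + 1)).of_isClosed_subset ?_ this
    exact isClosed_le (by fun_prop) continuous_const
  have hB0 : 0 ≤ B := (abs_nonneg _).trans (hB z)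
  obtain ⟨w, hw, hmax⟩ := hcl.exists_isMaxOn ⟨z, by simp; positivity⟩
    (f := fun w => a w - ‖z - w‖ ^ 2 / (2 * δ)) (by fun_prop)
  refine ⟨w, ?_, hw⟩
  apply le_antisymm
  · apply ciSup_le
    intro w'
    by_cases hw' : ‖z - w'‖ ^ 2 ≤ 4 * δ * B
    · exact hmax hw'
    · push Not at hw'
      have h1 : a z - ‖z - z‖ ^ 2 / (2 * δ) ≤ a w - ‖z - w‖ ^ 2 / (2 * δ) :=
        hmax (show ‖z - z‖ ^ 2 ≤ 4 * δ * B by simp; positivity)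
      have h2 : 2 * B < ‖z - w'‖ ^ 2 / (2 * δ) := by
        rw [lt_div_iff₀ (by positivity)]; linarith
      have h3 := (abs_le.1 (hB z)).1
      have h4 := (abs_le.1 (hB w')).2
      simp at h1
      linarith
  · exact le_supc hδ hB z w

lemma supc_bdd {δ B : ℝ} (hδ : 0 < δ) {a : E → ℝ} (ha : Continuous a)
    (hB : ∀ z, |a z| ≤ B) (z : E) : |supc δ a z| ≤ B := by
  obtain ⟨w, hw, -⟩ := exists_supc hδ ha hB z
  have h1 := le_supc hδ hB z z
  simp at h1
  have h3 := (abs_le.1 (hB z)).1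
  have h4 := (abs_le.1 (hB w)).2
  have : 0 ≤ ‖z - w‖ ^ 2 / (2 * δ) := by positivity
  rw [abs_le]; constructor <;> linarith

lemma supc_cont {δ B : ℝ} (hδ : 0 < δ) {a : E → ℝ} (ha : Continuous a)
    (hB : ∀ z, |a z| ≤ B) : Continuous (supc δ a) := by
  have hB0 : 0 ≤ B := (abs_nonneg _).trans (hB 0)
  set D := √(4 * δ * B) with hD
  have key : ∀ z z' : E, supc δ a z - supc δ a z' ≤ (2 * D * ‖z' - z‖ + ‖z' - z‖ ^ 2) / (2 * δ) := by
    intro z z'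
    obtain ⟨w, hw, hwD⟩ := exists_supc hδ ha hB z
    have h1 := le_supc hδ hB z' w
    have h2 : ‖z - w‖ ≤ D := Real.le_sqrt_of_sq_le hwD
    have h3 : ‖z' - w‖ ≤ ‖z' - z‖ + ‖z - w‖ := by
      simpa using norm_add_le (z' - z) (z - w)
    have h4 : ‖z' - w‖ ^ 2 ≤ ‖z - w‖ ^ 2 + (2 * D * ‖z' - z‖ + ‖z' - z‖ ^ 2) := by
      have := pow_le_pow_left₀ (norm_nonneg _) h3 2
      nlinarith [norm_nonneg (z' - z), mul_le_mul_of_nonneg_left h2 (norm_nonneg (z' - z))]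
    have h5 := div_le_div_of_nonneg_right h4 (show 0 ≤ 2 * δ by positivity)
    rw [add_div] at h5
    linarith
  rw [continuous_iff_continuousAt]
  intro z
  rw [ContinuousAt, tendsto_iff_dist_tendsto_zero]
  have hlim : Filter.Tendsto (fun z' => (2 * D * ‖z' - z‖ + ‖z' - z‖ ^ 2) / (2 * δ)) (nhds z) (nhds 0) := by
    have : Continuous (fun z' : E => (2 * D * ‖z' - z‖ + ‖z' - z‖ ^ 2) / (2 * δ)) := by fun_prop
    simpa using this.tendsto z
  refine squeeze_zero (fun _ => dist_nonneg) (fun z' => ?_) hlim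
  rw [Real.dist_eq, abs_le]
  have h1 := key z z'
  have h2 := key z' z
  rw [norm_sub_rev z z'] at h2
  constructor <;> linarith

lemma infc_le {δ B : ℝ} (hδ : 0 < δ) {a : E → ℝ} (hB : ∀ z, |a z| ≤ B) (z w : E) :
    infc δ a z ≤ a w + ‖z - w‖ ^ 2 / (2 * δ) := by
  have := le_supc hδ (a := fun w => - a w) (B := B) (by simpa using hB) z w
  simp only [infc]; linarith

lemma exists_infc {δ B : ℝ} (hδ : 0 < δ) {a : E → ℝ} (ha : Continuous a)
    (hB : ∀ z, |a z| ≤ B) (z : E) :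
    ∃ w, infc δ a z = a w + ‖z - w‖ ^ 2 / (2 * δ) := by
  obtain ⟨w, hw, -⟩ := exists_supc hδ (a := fun w => - a w) (B := B) ha.neg (by simpa using hB) z
  exact ⟨w, by simp only [infc]; linarith⟩

/-- Lasry–Lions regularization -/
def reg (δ : ℝ) (a : E → ℝ) : E → ℝ := infc δ (supc (2 * δ) a)

variable {δ B : ℝ} {a : E → ℝ}

lemma supc_mid (hδ : 0 < δ) (ha : Continuous a) (hB : ∀ z, |a z| ≤ B) (w k : E) :
    2 * supc (2 * δ) a w ≤ supc (2 * δ) a (w + k) + supc (2 * δ) a (w - k) + ‖k‖ ^ 2 / (2 * δ) := by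
  obtain ⟨y, hy, -⟩ := exists_supc (show 0 < 2 * δ by positivity) ha hB w
  have h1 := le_supc (show 0 < 2 * δ by positivity) hB (w + k) y
  have h2 := le_supc (show 0 < 2 * δ by positivity) hB (w - k) y
  have h3 : ‖w + k - y‖ ^ 2 + ‖w - k - y‖ ^ 2 = 2 * ‖w - y‖ ^ 2 + 2 * ‖k‖ ^ 2 := by
    have := parallelogram_law_with_norm ℝ (w - y) k
    rw [show w + k - y = (w - y) + k by abel, show w - k - y = (w - y) - k by abel]
    nlinarith
  have h4 : ‖w + k - y‖ ^ 2 / (2 * (2 * δ)) + ‖w - k - y‖ ^ 2 / (2 * (2 * δ))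
      = 2 * (‖w - y‖ ^ 2 / (2 * (2 * δ))) + ‖k‖ ^ 2 / (2 * δ) := by
    rw [← add_div, h3]; field_simp
  linarith

lemma reg_mid (hδ : 0 < δ) (ha : Continuous a) (hB : ∀ z, |a z| ≤ B) (z k : E) :
    2 * reg δ a z ≤ reg δ a (z + k) + reg δ a (z - k) + ‖k‖ ^ 2 / δ := by
  have h2δ : 0 < 2 * δ := by positivity
  have hc := supc_cont h2δ ha hB
  have hb := supc_bdd h2δ ha hB
  obtain ⟨w1, hw1⟩ := exists_infc hδ hc hb (z + k)
  obtain ⟨w2, hw2⟩ := exists_infc hδ hc hb (z - k)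
  set w := (1 / 2 : ℝ) • (w1 + w2) with hw
  set l := (1 / 2 : ℝ) • (w1 - w2) with hl
  have e1 : w1 = w + l := by simp only [hw, hl]; module
  have e2 : w2 = w - l := by simp only [hw, hl]; module
  have h1 := infc_le hδ hb z w
  have h2 := supc_mid hδ ha hB w l
  have h3 : ‖z + k - w1‖ ^ 2 + ‖z - k - w2‖ ^ 2 = 2 * ‖z - w‖ ^ 2 + 2 * ‖k - l‖ ^ 2 := by
    have := parallelogram_law_with_norm ℝ (z - w) (k - l)
    rw [e1, e2, show z + k - (w + l) = (z - w) + (k - l) by abel,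
      show z - k - (w - l) = (z - w) - (k - l) by abel]
    nlinarith
  have h4 : ‖l‖ ^ 2 ≤ 2 * ‖k - l‖ ^ 2 + 2 * ‖k‖ ^ 2 := by
    have h5 : ‖l‖ ≤ ‖k‖ + ‖k - l‖ := by
      have := norm_sub_le k (k - l); simpa using this
    have := pow_le_pow_left₀ (norm_nonneg _) h5 2
    nlinarith [sq_nonneg (‖k‖ - ‖k - l‖)]
  have h6 : ‖z + k - w1‖ ^ 2 / (2 * δ) + ‖z - k - w2‖ ^ 2 / (2 * δ)
      = 2 * (‖z - w‖ ^ 2 / (2 * δ)) + (2 * ‖k - l‖ ^ 2) / (2 * δ) := by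
    rw [← add_div, h3]; field_simp
  have h7 := div_le_div_of_nonneg_right h4 h2δ.le
  have h8 : (2 * ‖k - l‖ ^ 2 + 2 * ‖k‖ ^ 2) / (2 * δ) = (2 * ‖k - l‖ ^ 2) / (2 * δ) + ‖k‖ ^ 2 / δ := by
    field_simp
  simp only [reg]
  rw [hw1, hw2, e1, e2]
  rw [e1, e2] at h6
  linarith

lemma sq_expand (z w k : E) (hδ : 0 < δ) : ‖z + k - w‖ ^ 2 / (2 * δ) =
    ‖z - w‖ ^ 2 / (2 * δ) + ⟪(1 / δ) • (z - w), k⟫ + ‖k‖ ^ 2 / (2 * δ) := by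
  rw [show z + k - w = (z - w) + k by abel, norm_add_sq_real, real_inner_smul_left]
  field_simp

lemma reg_expand (hδ : 0 < δ) (ha : Continuous a) (hB : ∀ z, |a z| ≤ B) (z w : E)
    (hw : reg δ a z = supc (2 * δ) a w + ‖z - w‖ ^ 2 / (2 * δ)) (k : E) :
    |reg δ a (z + k) - reg δ a z - ⟪(1 / δ) • (z - w), k⟫| ≤ (2 / δ) * ‖k‖ ^ 2 := by
  have h2δ : 0 < 2 * δ := by positivity
  have hb := supc_bdd h2δ ha hB
  have h1 : ∀ k, reg δ a (z + k) ≤ reg δ a z + ⟪(1 / δ) • (z - w), k⟫ + ‖k‖ ^ 2 / (2 * δ) := by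
    intro k
    have := infc_le hδ hb (z + k) w
    rw [sq_expand z w k hδ] at this
    simp only [reg] at hw ⊢
    linarith
  have h2 := h1 k
  have h3 := h1 (-k)
  have h4 := reg_mid hδ ha hB z k
  rw [← sub_eq_add_neg, inner_neg_right, norm_neg] at h3
  have e1 : ‖k‖ ^ 2 / (2 * δ) = (1 / 2) * (‖k‖ ^ 2 / δ) := by field_simp
  have e2 : (2 / δ) * ‖k‖ ^ 2 = 2 * (‖k‖ ^ 2 / δ) := by field_simp
  have e3 : 0 ≤ ‖k‖ ^ 2 / δ := by positivity
  rw [e1] at h2 h3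
  rw [e2, abs_le]
  constructor <;> linarith

lemma hasFDerivAt_of_sq {F : Type*} [NormedAddCommGroup F] [NormedSpace ℝ F] {v : F → ℝ} {z : F}
    {L : F →L[ℝ] ℝ} {c : ℝ}
    (h : ∀ k, |v (z + k) - v z - L k| ≤ c * ‖k‖ ^ 2) : HasFDerivAt v L z := by
  rw [hasFDerivAt_iff_isLittleO_nhds_zero]
  have : (fun k => v (z + k) - v z - L k) =O[nhds 0] fun k : F => ‖k‖ ^ 2 := by
    apply Asymptotics.IsBigO.of_bound c
    filter_upwards with k
    simpa using h k
  refine this.trans_isLittleO ?_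
  have h2 : (fun k : F => ‖k‖ ^ 2) =o[nhds 0] fun k : F => k := by
    simpa using (Asymptotics.isLittleO_norm_pow_id (E' := F) (n := 2) (by norm_num))
  exact h2

lemma reg_hasFDerivAt (hδ : 0 < δ) (ha : Continuous a) (hB : ∀ z, |a z| ≤ B) (z w : E)
    (hw : reg δ a z = supc (2 * δ) a w + ‖z - w‖ ^ 2 / (2 * δ)) :
    HasFDerivAt (reg δ a) (innerSL ℝ ((1 / δ) • (z - w))) z := by
  apply hasFDerivAt_of_sq (c := 2 / δ)
  intro k
  exact reg_expand hδ ha hB z w hw k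

lemma exists_reg (hδ : 0 < δ) (ha : Continuous a) (hB : ∀ z, |a z| ≤ B) (z : E) :
    ∃ w, reg δ a z = supc (2 * δ) a w + ‖z - w‖ ^ 2 / (2 * δ) :=
  exists_infc hδ (supc_cont (show 0 < 2 * δ by positivity) ha hB)
    (supc_bdd (show 0 < 2 * δ by positivity) ha hB) z

lemma reg_differentiable (hδ : 0 < δ) (ha : Continuous a) (hB : ∀ z, |a z| ≤ B) :
    Differentiable ℝ (reg δ a) := fun z => by
  obtain ⟨w, hw⟩ := exists_reg hδ ha hB z
  exact (reg_hasFDerivAt hδ ha hB z w hw).differentiableAt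

lemma reg_expand' (hδ : 0 < δ) (ha : Continuous a) (hB : ∀ z, |a z| ≤ B) (z k : E) :
    |reg δ a (z + k) - reg δ a z - fderiv ℝ (reg δ a) z k| ≤ (2 / δ) * ‖k‖ ^ 2 := by
  obtain ⟨w, hw⟩ := exists_reg hδ ha hB z
  rw [(reg_hasFDerivAt hδ ha hB z w hw).fderiv]
  exact reg_expand hδ ha hB z w hw k

lemma lip_of_sq {F : Type*} [NormedAddCommGroup F] [NormedSpace ℝ F] {v : F → ℝ}
    {D : F → (F →L[ℝ] ℝ)} {c : ℝ} (hc : 0 ≤ c)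
    (h : ∀ z k, |v (z + k) - v z - D z k| ≤ c * ‖k‖ ^ 2) :
    LipschitzWith (Real.toNNReal (6 * c)) D := by
  apply LipschitzWith.of_dist_le_mul
  intro z z'
  rw [dist_eq_norm, dist_eq_norm, Real.coe_toNNReal _ (by positivity)]
  apply ContinuousLinearMap.opNorm_le_of_unit_norm (by positivity)
  intro x hx
  by_cases hzz : z = z'
  · subst hzz; simp
  set r := ‖z - z'‖ with hr
  have hrpos : 0 < r := norm_pos_iff.2 (sub_ne_zero.2 hzz)
  have h1 := abs_le.1 (h z ((z' - z) + r • x))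
  have h2 := abs_le.1 (h z (z' - z))
  have h3 := abs_le.1 (h z' (r • x))
  have e0 : z + (z' - z) = z' := by abel
  have e1 : z + ((z' - z) + r • x) = z' + r • x := by abel
  rw [e1, map_add] at h1
  rw [e0] at h2
  have n1 : ‖z' - z‖ = r := norm_sub_rev _ _
  have n2 : ‖r • x‖ = r := by rw [norm_smul, hx, mul_one]; simp [abs_of_pos hrpos]
  have n3 : ‖(z' - z) + r • x‖ ^ 2 ≤ 4 * r ^ 2 := by
    have : ‖(z' - z) + r • x‖ ≤ 2 * r := by
      refine (norm_add_le _ _).trans ?_; rw [n1, n2]; linarith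
    nlinarith [norm_nonneg ((z' - z) + r • x)]
  have n4 := mul_le_mul_of_nonneg_left n3 hc
  rw [n1] at h2
  rw [n2] at h3
  have h5 : |D z (r • x) - D z' (r • x)| ≤ 6 * c * r ^ 2 := by
    rw [abs_le]; constructor <;> linarith [h1.1, h1.2, h2.1, h2.2, h3.1, h3.2]
  rw [map_smul, map_smul, smul_eq_mul, smul_eq_mul, ← mul_sub, abs_mul, abs_of_pos hrpos] at h5
  rw [Real.norm_eq_abs, sub_apply]
  have : r * |D z x - D z' x| ≤ r * (6 * c * r) := by linarith
  exact le_of_mul_le_mul_left this hrpos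

lemma reg_lip (hδ : 0 < δ) (ha : Continuous a) (hB : ∀ z, |a z| ≤ B) :
    LipschitzWith (Real.toNNReal (6 * (2 / δ))) (fderiv ℝ (reg δ a)) :=
  lip_of_sq (by positivity) (reg_expand' hδ ha hB)

lemma supc_le_reg (hδ : 0 < δ) (ha : Continuous a) (hB : ∀ z, |a z| ≤ B) (z : E) :
    supc δ a z ≤ reg δ a z := by
  obtain ⟨w, hw⟩ := exists_reg hδ ha hB z
  obtain ⟨y, hy, -⟩ := exists_supc hδ ha hB z
  have h1 := le_supc (show 0 < 2 * δ by positivity) hB w y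
  have h2 : ‖w - y‖ ^ 2 ≤ 2 * ‖z - w‖ ^ 2 + 2 * ‖z - y‖ ^ 2 := by
    have h5 : ‖w - y‖ ≤ ‖z - w‖ + ‖z - y‖ := by
      have := norm_sub_le (z - y) (z - w); simp at this; linarith
    have := pow_le_pow_left₀ (norm_nonneg _) h5 2
    nlinarith [sq_nonneg (‖z - w‖ - ‖z - y‖)]
  have h3 := div_le_div_of_nonneg_right h2 (show 0 ≤ 2 * (2 * δ) by positivity)
  have h4 : (2 * ‖z - w‖ ^ 2 + 2 * ‖z - y‖ ^ 2) / (2 * (2 * δ)) =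
    ‖z - w‖ ^ 2 / (2 * δ) + ‖z - y‖ ^ 2 / (2 * δ) := by field_simp
  linarith

lemma le_reg (hδ : 0 < δ) (ha : Continuous a) (hB : ∀ z, |a z| ≤ B) (z : E) :
    a z ≤ reg δ a z := by
  have := le_supc hδ hB z z
  simp at this
  exact this.trans (supc_le_reg hδ ha hB z)

lemma reg_le (hδ : 0 < δ) (ha : Continuous a) (hB : ∀ z, |a z| ≤ B) (z : E) :
    ∃ w, reg δ a z ≤ a w ∧ ‖z - w‖ ^ 2 ≤ 8 * δ * B := by
  have h2δ : 0 < 2 * δ := by positivity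
  obtain ⟨w, hw, hw2⟩ := exists_supc h2δ ha hB z
  refine ⟨w, ?_, by linarith⟩
  have := infc_le hδ (supc_bdd h2δ ha hB) z z
  have h3 : 0 ≤ ‖z - w‖ ^ 2 / (2 * (2 * δ)) := by positivity
  simp at this
  simp only [reg]
  linarith

lemma seg_id (z0 d w : E) (s : ℝ) : ‖z0 + s • d - w‖ ^ 2 + s * (1 - s) * ‖d‖ ^ 2 =
    (1 - s) * ‖z0 - w‖ ^ 2 + s * ‖z0 + d - w‖ ^ 2 := by
  rw [show z0 + s • d - w = (z0 - w) + s • d by abel, show z0 + d - w = (z0 - w) + d by abel,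
    norm_add_sq_real, norm_add_sq_real, inner_smul_right, norm_smul, mul_pow]
  simp only [Real.norm_eq_abs, sq_abs]
  ring

lemma reg_contact (hδ : 0 < δ) (ha : Continuous a) (hB : ∀ z, |a z| ≤ B) (z0 : E) {C : ℝ}
    (hC : C < 1 / (2 * δ))
    (h : ∀ᶠ k in nhds (0 : E), reg δ a (z0 + k) ≤ reg δ a z0 + fderiv ℝ (reg δ a) z0 k + C * ‖k‖ ^ 2) :
    reg δ a z0 = supc δ a z0 := by
  have h2δ : 0 < 2 * δ := by positivity
  have hc := supc_cont h2δ ha hB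
  have hb := supc_bdd h2δ ha hB
  obtain ⟨w0, hw0⟩ := exists_reg hδ ha hB z0
  obtain ⟨y, hy, -⟩ := exists_supc h2δ ha hB w0
  -- the true point z1 = midpoint of w0 and y
  set z1 := (1 / 2 : ℝ) • (w0 + y) with hz1
  have hfd := (reg_hasFDerivAt hδ ha hB z0 w0 hw0).fderiv
  have hmid : ‖w0 - y‖ ^ 2 / (2 * (2 * δ)) = ‖z1 - w0‖ ^ 2 / (2 * δ) + ‖z1 - y‖ ^ 2 / (2 * δ) := by
    rw [show z1 - w0 = (-(1 / 2) : ℝ) • (w0 - y) by simp only [hz1]; module,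
      show z1 - y = ((1 / 2) : ℝ) • (w0 - y) by simp only [hz1]; module, norm_smul, norm_smul]
    simp only [mul_pow, Real.norm_eq_abs, sq_abs]
    field_simp; norm_num
  have hg1 : supc (2 * δ) a w0 + ‖z1 - w0‖ ^ 2 / (2 * δ) ≤ supc δ a z1 := by
    have := le_supc hδ hB z1 y
    linarith
  have hv1 : reg δ a z1 = supc (2 * δ) a w0 + ‖z1 - w0‖ ^ 2 / (2 * δ) := by
    apply le_antisymm
    · exact infc_le hδ hb z1 w0
    · exact hg1.trans (supc_le_reg hδ ha hB z1)
  by_cases hz : z1 = z0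
  · rw [hz] at hg1
    apply le_antisymm _ (supc_le_reg hδ ha hB z0)
    linarith
  exfalso
  set d := z1 - z0 with hd
  have hdne : d ≠ 0 := sub_ne_zero.2 hz
  have hseg : ∀ s ∈ Icc (0 : ℝ) 1, supc (2 * δ) a w0 + ‖z0 + s • d - w0‖ ^ 2 / (2 * δ)
      ≤ reg δ a (z0 + s • d) := by
    intro s hs
    obtain ⟨w, hw⟩ := exists_reg hδ ha hB (z0 + s • d)
    have h1 := infc_le hδ hb z0 w
    have h2 := infc_le hδ hb z1 w
    have e1 : z0 + d = z1 := by simp [hd]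
    have i1 := seg_id z0 d w s
    have i2 := seg_id z0 d w0 s
    rw [e1] at i1 i2
    change reg δ a z0 ≤ _ at h1
    change reg δ a z1 ≤ _ at h2
    rw [hw0] at h1
    rw [hv1] at h2
    have h1' := mul_le_mul_of_nonneg_left h1 (sub_nonneg.2 hs.2)
    have h2' := mul_le_mul_of_nonneg_left h2 hs.1
    have j1 : ‖z0 + s • d - w‖ ^ 2 / (2 * δ) = (1 - s) * (‖z0 - w‖ ^ 2 / (2 * δ)) +
      s * (‖z1 - w‖ ^ 2 / (2 * δ)) - s * (1 - s) * ‖d‖ ^ 2 / (2 * δ) := by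
      field_simp; linarith
    have j2 : ‖z0 + s • d - w0‖ ^ 2 / (2 * δ) = (1 - s) * (‖z0 - w0‖ ^ 2 / (2 * δ)) +
      s * (‖z1 - w0‖ ^ 2 / (2 * δ)) - s * (1 - s) * ‖d‖ ^ 2 / (2 * δ) := by
      field_simp; linarith
    rw [hw, j1, j2]
    nlinarith
  have hcont : Filter.Tendsto (fun s : ℝ => s • d) (nhdsWithin 0 (Ioi 0)) (nhds 0) := by
    have : Continuous (fun s : ℝ => s • d) := by fun_prop
    have h2 := this.tendsto 0
    simp only [zero_smul] at h2
    exact h2.mono_left nhdsWithin_le_nhds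
  have hev := hcont.eventually h
  have hev2 : ∀ᶠ s in nhdsWithin (0 : ℝ) (Ioi 0), s ∈ Ioo (0 : ℝ) 1 :=
    Ioo_mem_nhdsGT one_pos
  obtain ⟨s, hs1, hs2⟩ := (hev.and hev2).exists
  have h3 := hseg s ⟨hs2.1.le, hs2.2.le⟩
  rw [sq_expand z0 w0 _ hδ] at h3
  rw [hfd] at hs1
  simp only [innerSL_apply_apply] at hs1
  have h4 : ‖s • d‖ ^ 2 / (2 * δ) ≤ C * ‖s • d‖ ^ 2 := by linarith
  have h5 : 0 < ‖s • d‖ ^ 2 := by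
    have : 0 < ‖s • d‖ := norm_pos_iff.2 (smul_ne_zero hs2.1.ne' hdne)
    positivity
  have h6 := mul_lt_mul_of_pos_right hC h5
  rw [one_div, inv_mul_eq_div] at h6
  linarith

lemma contact_transfer (hδ : 0 < δ) (ha : Continuous a) (hB : ∀ z, |a z| ≤ B) (z0 : E)
    (h : reg δ a z0 = supc δ a z0) :
    ∃ z', ‖z0 - z'‖ ^ 2 ≤ 4 * δ * B ∧ ∀ k, a (z' + k) - a z' ≤ reg δ a (z0 + k) - reg δ a z0 := by
  obtain ⟨z', hz, hz2⟩ := exists_supc hδ ha hB z0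
  refine ⟨z', hz2, fun k => ?_⟩
  have h1 := le_supc hδ hB (z0 + k) (z' + k)
  rw [add_sub_add_right_eq_sub] at h1
  have h2 := supc_le_reg hδ ha hB (z0 + k)
  linarith
end Reg

lemma generic_max {F : Type*} [NormedAddCommGroup F] [NormedSpace ℝ F] [FiniteDimensional ℝ F]
    {Φ : F → ℝ} (hd : Differentiable ℝ Φ) {K : NNReal} (hL : LipschitzWith K (fderiv ℝ Φ))
    (c : F) {ρ m η : ℝ} (hρ : 0 < ρ) (hm : 0 < m) (hη : 0 < η)
    (hs : ∀ z, ‖z - c‖ = ρ → Φ z ≤ Φ c - m) :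
    ∃ (z : F) (p : F →L[ℝ] ℝ), ‖z - c‖ < ρ ∧ ‖p‖ < η ∧ IsLocalMax (fun y => Φ y - p y) z ∧
      DifferentiableAt ℝ (fderiv ℝ Φ) z ∧ fderiv ℝ Φ z = p := by
  let _ : MeasurableSpace F := borel F
  have _ : BorelSpace F := ⟨rfl⟩
  let _ : MeasurableSpace (F →L[ℝ] ℝ) := borel _
  have _ : BorelSpace (F →L[ℝ] ℝ) := ⟨rfl⟩
  set d := Module.finrank ℝ F with hdd
  have hdual : Module.finrank ℝ (F →L[ℝ] ℝ) = d := by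
    have e : (F →ₗ[ℝ] ℝ) ≃ₗ[ℝ] (F →L[ℝ] ℝ) := LinearMap.toContinuousLinearMap
    rw [← e.finrank_eq]
    exact Subspace.dual_finrank_eq
  set Z := {z | ¬ DifferentiableAt ℝ (fderiv ℝ Φ) z} with hZ
  have hZ0 : MeasureTheory.Measure.hausdorffMeasure (d : ℝ) Z = 0 := by
    have := hL.ae_differentiableAt (μ := MeasureTheory.Measure.hausdorffMeasure (d : ℝ))
    exact this
  have himg : MeasureTheory.Measure.hausdorffMeasure (d : ℝ) (fderiv ℝ Φ '' Z) = 0 := by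
    have := hL.hausdorffMeasure_image_le (d := (d : ℝ)) (by positivity) Z
    rw [hZ0, mul_zero] at this
    exact le_antisymm this bot_le
  set η' := min η (m / (2 * ρ)) with hη'
  have hη'0 : 0 < η' := lt_min hη (by positivity)
  have hball : MeasureTheory.Measure.hausdorffMeasure (d : ℝ) (Metric.ball (0 : F →L[ℝ] ℝ) η') ≠ 0 := by
    have h1 : MeasureTheory.Measure.IsAddHaarMeasure
      (MeasureTheory.Measure.hausdorffMeasure (d : ℝ) : MeasureTheory.Measure (F →L[ℝ] ℝ)) := by
      rw [← hdual]; infer_instance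
    exact (Metric.measure_ball_pos _ _ hη'0).ne'
  have hex : ∃ p ∈ Metric.ball (0 : F →L[ℝ] ℝ) η', p ∉ fderiv ℝ Φ '' Z := by
    by_contra! hcon
    exact hball (MeasureTheory.measure_mono_null hcon himg)
  obtain ⟨p, hpb, hpZ⟩ := hex
  rw [mem_ball_zero_iff] at hpb
  obtain ⟨z, hz, hmax⟩ := (isCompact_closedBall c ρ).exists_isMaxOn ⟨c, by simp [hρ.le]⟩
    (f := fun y => Φ y - p y) (by have := hd.continuous; fun_prop)
  have hzc : ‖z - c‖ < ρ := by
    rw [Metric.mem_closedBall, dist_eq_norm] at hz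
    refine lt_of_le_of_ne hz fun heq => ?_
    have h1 := hs z heq
    have h2 : Φ c - p c ≤ Φ z - p z := hmax (Metric.mem_closedBall_self hρ.le)
    have h3 : |p (z - c)| ≤ ‖p‖ * ‖z - c‖ := p.le_opNorm _
    rw [map_sub, heq] at h3
    have h4 : ‖p‖ * ρ ≤ m / (2 * ρ) * ρ :=
      mul_le_mul_of_nonneg_right (hpb.le.trans (min_le_right _ _)) hρ.le
    have h5 : m / (2 * ρ) * ρ = m / 2 := by field_simp
    have := (abs_le.1 h3).1
    linarith
  have hloc : IsLocalMax (fun y => Φ y - p y) z := by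
    apply hmax.isLocalMax
    apply Filter.mem_of_superset (Metric.ball_mem_nhds z (sub_pos.2 hzc))
    intro y hy
    rw [Metric.mem_ball] at hy
    rw [Metric.mem_closedBall]
    have := dist_triangle y z c
    rw [dist_eq_norm z c] at this
    linarith
  have hfd : fderiv ℝ Φ z = p := by
    have h1 : HasFDerivAt (fun y => Φ y - p y) (fderiv ℝ Φ z - p) z :=
      (hd z).hasFDerivAt.sub p.hasFDerivAt
    exact sub_eq_zero.1 (hloc.hasFDerivAt_eq_zero h1)
  refine ⟨z, p, hzc, hpb.trans_le (min_le_left _ _), hloc, ?_, hfd⟩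
  by_contra hnd
  exact hpZ ⟨z, hnd, hfd⟩

lemma taylor2 {F : Type*} [NormedAddCommGroup F] [NormedSpace ℝ F]
    {v : F → ℝ} {z : F} {X : F →L[ℝ] F →L[ℝ] ℝ} (hd : ∀ᶠ y in nhds z, DifferentiableAt ℝ v y)
    (hX : HasFDerivAt (fderiv ℝ v) X z) {ε : ℝ} (hε : 0 < ε) :
    ∀ᶠ k in nhds (0 : F), |v (z + k) - v z - fderiv ℝ v z k - X k k / 2| ≤ ε * ‖k‖ ^ 2 := by
  have hsym : ∀ a b, X a b = X b a := by
    intro a b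
    exact second_derivative_symmetric_of_eventually
      (f' := fderiv ℝ v) (hd.mono fun y hy => hy.hasFDerivAt) hX a b
  rw [hasFDerivAt_iff_isLittleO_nhds_zero] at hX
  have h1 := hX.def hε
  have hd' : ∀ᶠ k in nhds (0 : F), DifferentiableAt ℝ v (z + k) := by
    have : Filter.Tendsto (fun k : F => z + k) (nhds 0) (nhds z) := by
      have : Continuous (fun k : F => z + k) := by fun_prop
      simpa using this.tendsto 0
    exact this.eventually hd
  obtain ⟨ρ, hρ, hball⟩ := Metric.eventually_nhds_iff_ball.1 (h1.and hd')
  refine Metric.eventually_nhds_iff_ball.2 ⟨ρ, hρ, fun k hk => ?_⟩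
  rw [mem_ball_zero_iff] at hk
  set g : F → ℝ := fun k => v (z + k) - v z - fderiv ℝ v z k - X k k / 2 with hg
  have hder : ∀ y ∈ Metric.closedBall (0 : F) ‖k‖, HasFDerivWithinAt g
      (fderiv ℝ v (z + y) - fderiv ℝ v z - X y) (Metric.closedBall (0 : F) ‖k‖) y := by
    intro y hy
    rw [mem_closedBall_zero_iff] at hy
    have hy' : y ∈ Metric.ball (0 : F) ρ := by rw [mem_ball_zero_iff]; linarith
    have hdy := (hball y hy').2
    apply HasFDerivAt.hasFDerivWithinAt
    have a1 : HasFDerivAt (fun k => v (z + k)) (fderiv ℝ v (z + y)) y := by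
      have := hdy.hasFDerivAt.comp y ((hasFDerivAt_id y).const_add z)
      rw [ContinuousLinearMap.comp_id] at this
      exact this
    have a2 : HasFDerivAt (fun k => X k k) (X y + X.flip y) y := by
      have := (X.hasFDerivAt (x := y)).clm_apply (hasFDerivAt_id y)
      rw [ContinuousLinearMap.comp_id] at this
      exact this
    have a3 := ((a1.sub_const (v z)).sub (fderiv ℝ v z).hasFDerivAt).sub (a2.mul_const (1/2))
    refine (a3.congr_fderiv ?_).congr_of_eventuallyEq ?_
    · ext l
      simp [hsym l y]
      ring
    · filter_upwards with l
      simp [hg]; ring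
  have hbd : ∀ y ∈ Metric.closedBall (0 : F) ‖k‖, ‖fderiv ℝ v (z + y) - fderiv ℝ v z - X y‖ ≤ ε * ‖k‖ := by
    intro y hy
    rw [mem_closedBall_zero_iff] at hy
    have hy' : y ∈ Metric.ball (0 : F) ρ := by rw [mem_ball_zero_iff]; linarith
    exact ((hball y hy').1).trans (mul_le_mul_of_nonneg_left hy hε.le)
  have := (convex_closedBall (0 : F) ‖k‖).norm_image_sub_le_of_norm_hasFDerivWithin_le hder hbd
    (x := 0) (y := k) (by simp) (by simp)
  have g0 : g 0 = 0 := by simp [hg]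
  rw [g0, sub_zero, sub_zero, Real.norm_eq_abs] at this
  nlinarith

section Ishii
variable {E : Type*} [NormedAddCommGroup E] [InnerProductSpace ℝ E] [FiniteDimensional ℝ E]

lemma quad_le {F : Type*} [NormedAddCommGroup F] [NormedSpace ℝ F] (Q : F →L[ℝ] F →L[ℝ] ℝ) (k : F) :
    |Q k k| ≤ ‖Q‖ * ‖k‖ ^ 2 := by
  have := Q.le_opNorm₂ k k
  rw [Real.norm_eq_abs] at this
  nlinarith

/-- uniform closeness of the regularization -/
lemma reg_close {B : ℝ} {a : E → ℝ} (ha : Continuous a) (hB : ∀ z, |a z| ≤ B) (c : E) (r : ℝ)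
    {m : ℝ} (hm : 0 < m) : ∃ δ0 > 0, ∀ δ, 0 < δ → δ < δ0 → ∀ z, ‖z - c‖ ≤ r → reg δ a z ≤ a z + m := by
  have hB0 : 0 ≤ B := (abs_nonneg _).trans (hB c)
  have huc := (isCompact_closedBall c (r + 1)).uniformContinuousOn_of_continuous
    (f := a) ha.continuousOn
  obtain ⟨σ, hσ, huc⟩ := Metric.uniformContinuousOn_iff.1 huc m hm
  set s := min σ 1 with hs
  have hs0 : 0 < s := lt_min hσ one_pos
  refine ⟨s ^ 2 / (8 * (B + 1)), by positivity, fun δ hδ hδ0 z hz => ?_⟩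
  obtain ⟨w, hw, hw2⟩ := reg_le hδ ha hB z
  have h1 : ‖z - w‖ ^ 2 < s ^ 2 := by
    rw [lt_div_iff₀ (by positivity)] at hδ0
    nlinarith
  have h2 : ‖z - w‖ < s := lt_of_pow_lt_pow_left₀ 2 hs0.le h1
  have h3 := huc z (by rw [Metric.mem_closedBall, dist_eq_norm]; linarith) w
    (by
      rw [Metric.mem_closedBall, dist_eq_norm]
      have : ‖w - c‖ ≤ ‖z - c‖ + ‖z - w‖ := by
        have := norm_sub_le (z - c) (z - w); simpa using this
      have := min_le_right σ 1
      linarith)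
    (by rw [dist_eq_norm]; exact h2.trans_le (min_le_left _ _))
  rw [Real.dist_eq] at h3
  have := (abs_lt.1 h3).1
  linarith

lemma quad_bd {F : Type*} [NormedAddCommGroup F] [NormedSpace ℝ F] (Q : F →L[ℝ] F →L[ℝ] ℝ) :
    ∃ N : ℝ, 0 ≤ N ∧ (∀ k, |Q k k| ≤ N * ‖k‖ ^ 2) ∧ ∀ k, ‖Q k‖ ≤ N * ‖k‖ :=
  ⟨‖Q‖, Q.opNorm_nonneg, quad_le Q, fun k => Q.le_opNorm k⟩

set_option maxHeartbeats 1000000 in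
theorem ishii {a b : E → ℝ} {B : ℝ} (ha : Continuous a) (hb : Continuous b)
    (hBa : ∀ z, |a z| ≤ B) (hBb : ∀ z, |b z| ≤ B) (zh wh : E) (P Q : E →L[ℝ] ℝ)
    (q : E × E →L[ℝ] E × E →L[ℝ] ℝ) (hq : ∀ x y, q x y = q y x) {ρ η : ℝ} (hρ : 0 < ρ) (hη : 0 < η)
    (h : ∀ k l, ‖k‖ ≤ ρ → ‖l‖ ≤ ρ → a (zh + k) + b (wh + l) + η * (‖k‖ ^ 2 + ‖l‖ ^ 2)
      ≤ a zh + b wh + P k + Q l + q (k, l) (k, l) / 2)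
    {ε : ℝ} (hε : 0 < ε) :
    ∃ (z w : E) (P' Q' : E →L[ℝ] ℝ) (X Y : E →L[ℝ] E →L[ℝ] ℝ),
      ‖z - zh‖ < ε ∧ ‖w - wh‖ < ε ∧ ‖P' - P‖ < ε ∧ ‖Q' - Q‖ < ε ∧
      (∀ k l, X k l = X l k) ∧ (∀ k l, Y k l = Y l k) ∧
      (∀ τ > 0, ∀ᶠ k in nhds (0 : E), a (z + k) ≤ a z + P' k + X k k / 2 + τ * ‖k‖ ^ 2) ∧
      (∀ τ > 0, ∀ᶠ k in nhds (0 : E), b (w + k) ≤ b w + Q' k + Y k k / 2 + τ * ‖k‖ ^ 2) ∧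
      ∀ k l, X k k + Y l l ≤ q (k, l) (k, l) := by
  have hB0 : 0 ≤ B := (abs_nonneg _).trans (hBa zh)
  obtain ⟨N, hN0, hNq, hNl⟩ := quad_bd q
  set r := min ρ (min (ε / 2) (ε / (2 * (N + 1)))) with hr
  have hr0 : 0 < r := by
    refine lt_min hρ (lt_min (by positivity) (by positivity))
  have hrρ : r ≤ ρ := min_le_left _ _
  have hrε : r ≤ ε / 2 := (min_le_right _ _).trans (min_le_left _ _)
  have hrq : N * r ≤ ε / 2 := by
    have h1 : r ≤ ε / (2 * (N + 1)) := (min_le_right _ _).trans (min_le_right _ _)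
    rw [le_div_iff₀ (by positivity)] at h1
    nlinarith
  obtain ⟨δ1, hδ1, hcl1⟩ := reg_close ha hBa zh r (m := η * r ^ 2 / 4) (by positivity)
  obtain ⟨δ2, hδ2, hcl2⟩ := reg_close hb hBb wh r (m := η * r ^ 2 / 4) (by positivity)
  obtain ⟨δ, hδ, hδl1, hδl2, hδl3, hδl4⟩ : ∃ δ > 0, δ < δ1 ∧ δ < δ2 ∧ δ * (2 * (N + 1)) ≤ 1 ∧
      δ * (4 * (B + 1)) ≤ (ε / 2) ^ 2 := by
    refine ⟨min (δ1 / 2) (min (δ2 / 2) (min (1 / (2 * (N + 1))) ((ε / 2) ^ 2 / (4 * (B + 1))))),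
      ?_, ?_, ?_, ?_, ?_⟩
    · refine lt_min (by positivity) (lt_min (by positivity) (lt_min (by positivity) (by positivity)))
    · exact (min_le_left _ _).trans_lt (by linarith)
    · exact ((min_le_right _ _).trans (min_le_left _ _)).trans_lt (by linarith)
    · rw [← le_div_iff₀ (by positivity)]
      exact (min_le_right _ _).trans ((min_le_right _ _).trans (min_le_left _ _))
    · rw [← le_div_iff₀ (by positivity)]
      exact (min_le_right _ _).trans ((min_le_right _ _).trans (min_le_right _ _))
  set va := reg δ a with hva
  set vb := reg δ b with hvb
  set c : E × E := (zh, wh) with hc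
  set ℓ : E × E →L[ℝ] ℝ := P.comp (ContinuousLinearMap.fst ℝ E E) +
    Q.comp (ContinuousLinearMap.snd ℝ E E) with hℓ
  set Φ : E × E → ℝ := fun y => va y.1 + vb y.2 - ℓ (y - c) - q (y - c) (y - c) / 2 with hΦ
  set D : E × E → (E × E →L[ℝ] ℝ) := fun y =>
    (fderiv ℝ va y.1).comp (ContinuousLinearMap.fst ℝ E E) +
    (fderiv ℝ vb y.2).comp (ContinuousLinearMap.snd ℝ E E) - ℓ - q (y - c) with hD
  have hexp : ∀ y κ, |Φ (y + κ) - Φ y - D y κ| ≤ (4 / δ + N) * ‖κ‖ ^ 2 := by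
    intro y κ
    have h1 := abs_le.1 (reg_expand' hδ ha hBa y.1 κ.1)
    have h2 := abs_le.1 (reg_expand' hδ hb hBb y.2 κ.2)
    have h3 := abs_le.1 (hNq κ)
    have e : Φ (y + κ) - Φ y - D y κ = (va (y.1 + κ.1) - va y.1 - fderiv ℝ va y.1 κ.1) +
      (vb (y.2 + κ.2) - vb y.2 - fderiv ℝ vb y.2 κ.2) - q κ κ / 2 := by
      simp only [hΦ, hD, Prod.fst_add, Prod.snd_add]
      rw [show y + κ - c = (y - c) + κ by abel]
      simp only [map_add, add_apply, sub_apply, ContinuousLinearMap.comp_apply,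
        ContinuousLinearMap.coe_fst', ContinuousLinearMap.coe_snd']
      rw [hq κ (y - c)]
      ring
    have n1 : ‖κ.1‖ ^ 2 ≤ ‖κ‖ ^ 2 := pow_le_pow_left₀ (norm_nonneg _) (norm_fst_le κ) 2
    have n2 : ‖κ.2‖ ^ 2 ≤ ‖κ‖ ^ 2 := pow_le_pow_left₀ (norm_nonneg _) (norm_snd_le κ) 2
    have m1 := mul_le_mul_of_nonneg_left n1 (show 0 ≤ 2 / δ by positivity)
    have m2 := mul_le_mul_of_nonneg_left n2 (show 0 ≤ 2 / δ by positivity)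
    have e2 : (4 / δ + N) * ‖κ‖ ^ 2 = 2 / δ * ‖κ‖ ^ 2 + 2 / δ * ‖κ‖ ^ 2 + N * ‖κ‖ ^ 2 := by ring
    have e3 : 0 ≤ N * ‖κ‖ ^ 2 := by positivity
    rw [e, e2, abs_le]
    constructor <;> linarith [h1.1, h1.2, h2.1, h2.2, h3.1, h3.2]
  have hfd : ∀ y, HasFDerivAt Φ (D y) y := fun y => hasFDerivAt_of_sq (hexp y)
  have hfd' : fderiv ℝ Φ = D := funext fun y => (hfd y).fderiv
  have hlip : LipschitzWith (Real.toNNReal (6 * (4 / δ + N))) (fderiv ℝ Φ) := by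
    rw [hfd']; exact lip_of_sq (by positivity) hexp
  have hΦc : a zh + b wh ≤ Φ c := by
    have := le_reg hδ ha hBa zh
    have := le_reg hδ hb hBb wh
    simp [hΦ, hc]
    linarith
  have hsph : ∀ y, ‖y - c‖ = r → Φ y ≤ Φ c - η * r ^ 2 / 2 := by
    intro y hy
    have hk : ‖y.1 - zh‖ ≤ r := hy ▸ norm_fst_le (y - c)
    have hl : ‖y.2 - wh‖ ≤ r := hy ▸ norm_snd_le (y - c)
    have h1 := hcl1 δ hδ hδl1 y.1 hk
    have h2 := hcl2 δ hδ hδl2 y.2 hl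
    have h3 := h (y.1 - zh) (y.2 - wh) (hk.trans hrρ) (hl.trans hrρ)
    rw [add_sub_cancel, add_sub_cancel] at h3
    have h4 : r ^ 2 ≤ ‖y.1 - zh‖ ^ 2 + ‖y.2 - wh‖ ^ 2 := by
      rw [Prod.norm_def] at hy
      rcases max_choice ‖(y - c).1‖ ‖(y - c).2‖ with h5 | h5
      · rw [h5] at hy
        have : ‖y.1 - zh‖ = r := hy
        rw [this]; nlinarith [sq_nonneg ‖y.2 - wh‖]
      · rw [h5] at hy
        have : ‖y.2 - wh‖ = r := hy
        rw [this]; nlinarith [sq_nonneg ‖y.1 - zh‖]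
    have h6 := mul_le_mul_of_nonneg_left h4 hη.le
    have h7 : Φ y = va y.1 + vb y.2 - (P (y.1 - zh) + Q (y.2 - wh)) -
      q (y.1 - zh, y.2 - wh) (y.1 - zh, y.2 - wh) / 2 := rfl
    rw [h7]
    linarith
  obtain ⟨y, p, hyc, hp, hloc, hdd, hfp⟩ := generic_max (fun y => (hfd y).differentiableAt) hlip c hr0
    (show 0 < η * r ^ 2 / 2 by positivity) (show 0 < ε / 2 by positivity) hsph
  obtain ⟨z0, w0⟩ := y
  -- key local inequality
  have hDy : D (z0, w0) = p := by rw [← hfp, hfd']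
  have hkey : ∀ᶠ κ in nhds (0 : E × E), va (z0 + κ.1) + vb (w0 + κ.2) ≤ va z0 + vb w0 +
      fderiv ℝ va z0 κ.1 + fderiv ℝ vb w0 κ.2 + q κ κ / 2 := by
    have ht : Filter.Tendsto (fun κ : E × E => (z0, w0) + κ) (nhds 0) (nhds (z0, w0)) := by
      have : Continuous (fun κ : E × E => (z0, w0) + κ) := by fun_prop
      simpa using this.tendsto 0
    filter_upwards [ht.eventually hloc] with κ hκ
    rw [← hDy] at hκ
    simp only [hΦ, hD, Prod.fst_add, Prod.snd_add] at hκ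
    rw [show (z0, w0) + κ - c = ((z0, w0) - c) + κ by abel] at hκ
    simp only [map_add, add_apply, sub_apply, ContinuousLinearMap.comp_apply,
        ContinuousLinearMap.coe_fst', ContinuousLinearMap.coe_snd', Prod.fst_add, Prod.snd_add] at hκ
    rw [hq κ ((z0, w0) - c)] at hκ
    linarith
  have hinl : Filter.Tendsto (fun k : E => ((k, 0) : E × E)) (nhds 0) (nhds 0) := by
    have : Continuous (fun k : E => ((k, 0) : E × E)) := by fun_prop
    exact this.tendsto' 0 0 rfl
  have hinr : Filter.Tendsto (fun k : E => ((0, k) : E × E)) (nhds 0) (nhds 0) := by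
    have : Continuous (fun k : E => ((0, k) : E × E)) := by fun_prop
    exact this.tendsto' 0 0 rfl
  have hCδ : N / 2 < 1 / (2 * δ) := by
    rw [lt_div_iff₀ (by positivity)]
    nlinarith [hN0]
  have hca : reg δ a z0 = supc δ a z0 := by
    apply reg_contact hδ ha hBa z0 hCδ
    filter_upwards [hinl.eventually hkey] with k hk
    have h1 := (abs_le.1 (hNq (k, 0))).2
    have h2 : ‖((k, 0) : E × E)‖ = ‖k‖ := by simp [Prod.norm_def]
    rw [h2] at h1
    simp only [add_zero, map_zero] at hk
    linarith
  have hcb : reg δ b w0 = supc δ b w0 := by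
    apply reg_contact hδ hb hBb w0 hCδ
    filter_upwards [hinr.eventually hkey] with k hk
    have h1 := (abs_le.1 (hNq (0, k))).2
    have h2 : ‖((0, k) : E × E)‖ = ‖k‖ := by simp [Prod.norm_def]
    rw [h2] at h1
    simp only [add_zero, map_zero] at hk
    linarith
  obtain ⟨z, hz, hza⟩ := contact_transfer hδ ha hBa z0 hca
  obtain ⟨w, hw, hwb⟩ := contact_transfer hδ hb hBb w0 hcb
  have hclose : ∀ x x' xh : E, ‖x - x'‖ ^ 2 ≤ 4 * δ * B → ‖x - xh‖ < r → ‖x' - xh‖ < ε := by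
    intro x x' xh h1 h2
    have h3 : ‖x - x'‖ ≤ ε / 2 := by
      have h4 : ‖x - x'‖ ^ 2 ≤ (ε / 2) ^ 2 := by linarith
      exact le_of_pow_le_pow_left₀ two_ne_zero (by positivity) h4
    have : ‖x' - xh‖ ≤ ‖x - xh‖ + ‖x - x'‖ := by
      have := norm_sub_le (x - xh) (x - x'); simpa using this
    linarith
  have hz0 : ‖z0 - zh‖ < r := (norm_fst_le ((z0, w0) - c)).trans_lt hyc
  have hw0 : ‖w0 - wh‖ < r := (norm_snd_le ((z0, w0) - c)).trans_lt hyc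
  -- differentiability of the two gradients
  have hda : DifferentiableAt ℝ (fderiv ℝ va) z0 := by
    have e : fderiv ℝ va = fun x => (fderiv ℝ Φ (x, w0)).comp (ContinuousLinearMap.inl ℝ E E) + P +
        (q ((x, w0) - c)).comp (ContinuousLinearMap.inl ℝ E E) := by
      funext x
      rw [hfd']
      ext k
      simp [hD, hℓ]
      try ring
    rw [e]
    have h1 : DifferentiableAt ℝ (fun x => fderiv ℝ Φ (x, w0)) z0 :=
      DifferentiableAt.comp (f := fun x : E => ((x, w0) : E × E)) z0 hdd (by fun_prop)
    exact ((h1.clm_comp (differentiableAt_const _)).add_const P).add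
      (DifferentiableAt.clm_comp (q.differentiableAt.comp (f := fun x : E => ((x, w0) : E × E) - c) z0 (by fun_prop)) (differentiableAt_const _))
  have hdb : DifferentiableAt ℝ (fderiv ℝ vb) w0 := by
    have e : fderiv ℝ vb = fun x => (fderiv ℝ Φ (z0, x)).comp (ContinuousLinearMap.inr ℝ E E) + Q +
        (q ((z0, x) - c)).comp (ContinuousLinearMap.inr ℝ E E) := by
      funext x
      rw [hfd']
      ext k
      simp [hD, hℓ]
      try ring
    rw [e]
    have h1 : DifferentiableAt ℝ (fun x => fderiv ℝ Φ (z0, x)) w0 :=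
      DifferentiableAt.comp (f := fun x : E => ((z0, x) : E × E)) w0 hdd (by fun_prop)
    exact ((h1.clm_comp (differentiableAt_const _)).add_const Q).add
      (DifferentiableAt.clm_comp (q.differentiableAt.comp (f := fun x : E => ((z0, x) : E × E) - c) w0 (by fun_prop)) (differentiableAt_const _))
  have hdva : ∀ᶠ x in nhds z0, DifferentiableAt ℝ va x :=
    Filter.Eventually.of_forall (reg_differentiable hδ ha hBa)
  have hdvb : ∀ᶠ x in nhds w0, DifferentiableAt ℝ vb x :=
    Filter.Eventually.of_forall (reg_differentiable hδ hb hBb)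
  have hrem : ‖p + q ((z0, w0) - c)‖ < ε := by
    have h1 := norm_add_le p (q ((z0, w0) - c))
    have h2 := hNl ((z0, w0) - c)
    have h3 := mul_le_mul_of_nonneg_left hyc.le (hN0)
    linarith
  refine ⟨z, w, fderiv ℝ va z0, fderiv ℝ vb w0, fderiv ℝ (fderiv ℝ va) z0, fderiv ℝ (fderiv ℝ vb) w0,
    hclose z0 z zh hz hz0, hclose w0 w wh hw hw0, ?_, ?_, ?_, ?_, ?_, ?_, ?_⟩
  · refine lt_of_le_of_lt ?_ hrem
    apply ContinuousLinearMap.opNorm_le_bound _ (norm_nonneg _)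
    intro k
    have e : (fderiv ℝ va z0 - P) k = (p + q ((z0, w0) - c)) (k, 0) := by
      rw [← hDy]; simp [hD, hℓ]
    rw [e]
    have := (p + q ((z0, w0) - c)).le_opNorm (k, 0)
    have h2 : ‖((k, 0) : E × E)‖ = ‖k‖ := by simp [Prod.norm_def]
    rwa [h2] at this
  · refine lt_of_le_of_lt ?_ hrem
    apply ContinuousLinearMap.opNorm_le_bound _ (norm_nonneg _)
    intro k
    have e : (fderiv ℝ vb w0 - Q) k = (p + q ((z0, w0) - c)) (0, k) := by
      rw [← hDy]; simp [hD, hℓ]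
    rw [e]
    have := (p + q ((z0, w0) - c)).le_opNorm (0, k)
    have h2 : ‖((0, k) : E × E)‖ = ‖k‖ := by simp [Prod.norm_def]
    rwa [h2] at this
  · intro k l
    exact second_derivative_symmetric_of_eventually
      (f' := fderiv ℝ va) (hdva.mono fun y hy => hy.hasFDerivAt) hda.hasFDerivAt k l
  · intro k l
    exact second_derivative_symmetric_of_eventually
      (f' := fderiv ℝ vb) (hdvb.mono fun y hy => hy.hasFDerivAt) hdb.hasFDerivAt k l
  · intro τ hτ
    filter_upwards [taylor2 hdva hda.hasFDerivAt hτ] with k hk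
    have := (abs_le.1 hk).2
    have := hza k
    linarith
  · intro τ hτ
    filter_upwards [taylor2 hdvb hdb.hasFDerivAt hτ] with k hk
    have := (abs_le.1 hk).2
    have := hwb k
    linarith
  · intro k l
    apply le_of_forall_pos_le_add
    intro e he
    set τ := e / (2 * (‖k‖ ^ 2 + ‖l‖ ^ 2 + 1)) with hτ
    have hτ0 : 0 < τ := by positivity
    have t0 : Filter.Tendsto (fun s : ℝ => s • (k, l)) (nhdsWithin 0 (Ioi 0)) (nhds (0 : E × E)) := by
      have : Continuous (fun s : ℝ => s • (k, l)) := by fun_prop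
      exact (this.tendsto' 0 0 (by simp)).mono_left nhdsWithin_le_nhds
    have t1 : Filter.Tendsto (fun s : ℝ => s • k) (nhdsWithin 0 (Ioi 0)) (nhds (0 : E)) := by
      have : Continuous (fun s : ℝ => s • k) := by fun_prop
      exact (this.tendsto' 0 0 (by simp)).mono_left nhdsWithin_le_nhds
    have t2 : Filter.Tendsto (fun s : ℝ => s • l) (nhdsWithin 0 (Ioi 0)) (nhds (0 : E)) := by
      have : Continuous (fun s : ℝ => s • l) := by fun_prop
      exact (this.tendsto' 0 0 (by simp)).mono_left nhdsWithin_le_nhds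
    obtain ⟨s, ⟨⟨⟨h1, h2⟩, h3⟩, hs⟩⟩ := (((t0.eventually hkey).and
      (t1.eventually (taylor2 hdva hda.hasFDerivAt hτ0))).and
      (t2.eventually (taylor2 hdvb hdb.hasFDerivAt hτ0))).and self_mem_nhdsWithin |>.exists
    have hs0 : 0 < s := hs
    have h2' := (abs_le.1 h2).1
    have h3' := (abs_le.1 h3).1
    simp only [Prod.smul_fst, Prod.smul_snd, map_smul, smul_apply, smul_eq_mul,
      norm_smul, mul_pow, Real.norm_eq_abs, sq_abs] at h1 h2' h3'
    set A := fderiv ℝ (fderiv ℝ va) z0 k k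
    set C := fderiv ℝ (fderiv ℝ vb) w0 l l
    set G := q (k, l) (k, l)
    have h4 : s ^ 2 * (A + C) ≤ s ^ 2 * (G + 2 * τ * (‖k‖ ^ 2 + ‖l‖ ^ 2)) := by nlinarith
    have h5 := le_of_mul_le_mul_left h4 (by positivity)
    have h6 : 2 * τ * (‖k‖ ^ 2 + ‖l‖ ^ 2) ≤ e := by
      have : τ * (2 * (‖k‖ ^ 2 + ‖l‖ ^ 2 + 1)) = e := by
        rw [hτ]; field_simp
      nlinarith
    linarith
end Ishii

section Jets
variable {n : ℕ}

/-- the first half of the definition of a subsolution -/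
def Sub1 (γ p : ℝ) (f u : En n × ℝ → ℝ) (Ω : Set (En n × ℝ)) : Prop :=
  ∀ z ∈ Ω, ∀ φ : En n × ℝ → ℝ, ContDiff ℝ 2 φ →
      sGrad φ z.1 z.2 ≠ 0 → φ z = u z → (∀ w ∈ Ω, u w ≤ φ w) →
      deriv (fun s => φ (z.1, s)) z.2
            - opVal γ p (sGrad φ z.1 z.2) (sHess φ z.1 z.2) ≤ f z

lemma sGrad_neg (φ : En n × ℝ → ℝ) (x : En n) (t : ℝ) :
    sGrad (fun w => - φ w) x t = - sGrad φ x t := by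
  unfold sGrad gradient
  rw [fderiv_fun_neg, map_neg]

lemma sHess_neg (φ : En n × ℝ → ℝ) (x : En n) (t : ℝ) :
    sHess (fun w => - φ w) x t = - sHess φ x t := by
  unfold sHess
  rw [show (fun y => sGrad (fun w => - φ w) y t) = fun y => - sGrad φ y t from
    funext fun y => sGrad_neg φ y t, fderiv_fun_neg]

lemma opVal_neg (γ p : ℝ) (q : En n) (H : En n →L[ℝ] En n) :
    opVal γ p (-q) (-H) = - opVal γ p q H := by
  unfold opVal
  rw [norm_neg]
  have h1 : LinearMap.trace ℝ (En n) (-H : En n →L[ℝ] En n).toLinearMap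
      = - LinearMap.trace ℝ (En n) H.toLinearMap := by
    rw [ContinuousLinearMap.toLinearMap_neg, map_neg]
  have h2 : ⟪(-H) (-q), -q⟫ = - ⟪H q, q⟫ := by
    simp
  rw [h1, h2]; ring

lemma sub1_neg {γ p : ℝ} {f u : En n × ℝ → ℝ} {Ω : Set (En n × ℝ)} (h : IsSupersol γ p f u Ω) :
    Sub1 γ p (fun z => - f z) (fun z => - u z) Ω := by
  intro z hz φ hφ hg he ht
  have := h.1 z hz (fun w => - φ w) hφ.neg (by rw [sGrad_neg]; simpa using hg)
    (by simp [he]) (fun w hw => by have := ht w hw; simp only at this; linarith)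
  rw [sGrad_neg, sHess_neg, opVal_neg] at this
  have e : deriv (fun s => - φ (z.1, s)) z.2 = - deriv (fun s => φ (z.1, s)) z.2 := by
    rw [deriv.fun_neg]
  rw [e] at this
  linarith

/-- polynomial test function -/
lemma test_space (H : En n →L[ℝ] En n) (hH : ∀ k l, ⟪H k, l⟫ = ⟪H l, k⟫) (q x : En n) (c ε K : ℝ) (y : En n) :
    HasFDerivAt (fun y => c + ⟪q, y - x⟫ + 1 / 2 * ⟪H (y - x), y - x⟫ + ε * ‖y - x‖ ^ 2
      + K * (‖y - x‖ ^ 2) ^ 2)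
      (innerSL ℝ (q + H (y - x) + (2 * ε) • (y - x) + (4 * K * ‖y - x‖ ^ 2) • (y - x))) y := by
  have hd : HasFDerivAt (fun y : En n => y - x) (ContinuousLinearMap.id ℝ (En n)) y :=
    (hasFDerivAt_id y).sub_const x
  have h1 : HasFDerivAt (fun y => ⟪q, y - x⟫) _ y := (hasFDerivAt_const q y).inner ℝ hd
  have h2 : HasFDerivAt (fun y => ⟪H (y - x), y - x⟫) _ y := (H.hasFDerivAt.comp y hd).inner ℝ hd
  have h3 := hd.norm_sq
  have h4 := ((((h1.const_add c).add (h2.const_mul (1 / 2))).add (h3.const_mul ε)).add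
    ((h3.pow 2).const_mul K))
  refine h4.congr_fderiv ?_
  ext k
  simp [inner_add_left, inner_smul_left, fderivInnerCLM_apply]
  rw [hH k (y - x), map_sub, inner_sub_left]
  ring

lemma sub_jet0 {γ p : ℝ} {f u : En n × ℝ → ℝ} {Mu : ℝ} (hs : Sub1 γ p f u (pCyl n 1))
    (hMu : ∀ z ∈ pCyl n 1, |u z| ≤ Mu) (z : En n × ℝ) (hz : z ∈ pCyl n 1) (q v : En n)
    (H : En n →L[ℝ] En n) (hH : ∀ k l, ⟪H k, l⟫ = ⟪H l, k⟫) (τ s : ℝ) (hq : q ≠ 0)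
    (jet : ∀ ε > 0, ∀ᶠ κ in nhds (0 : En n × ℝ), u (z + κ) ≤ u z + ⟪q, κ.1⟫ + τ * κ.2
      + 1 / 2 * ⟪H κ.1, κ.1⟫ + κ.2 * ⟪v, κ.1⟫ + s * κ.2 ^ 2 + ε * (‖κ.1‖ ^ 2 + κ.2 ^ 2)) :
    τ - opVal γ p q H ≤ f z := by
  -- perturbed inequality
  have key : ∀ ε : ℝ, ε > 0 → τ - opVal γ p q (H + (2 * ε) • ContinuousLinearMap.id ℝ (En n)) ≤ f z := by
    intro ε hε
    set T : En n × ℝ → ℝ := fun κ => ⟪q, κ.1⟫ + τ * κ.2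
      + 1 / 2 * ⟪H κ.1, κ.1⟫ + κ.2 * ⟪v, κ.1⟫ + s * κ.2 ^ 2 + ε * (‖κ.1‖ ^ 2 + κ.2 ^ 2) with hT
    have hTc : Continuous T := by fun_prop
    obtain ⟨ρ, hρ, hj⟩ := Metric.eventually_nhds_iff.1 (jet ε hε)
    obtain ⟨C, hC⟩ := (isCompact_closedBall (0 : En n × ℝ) 2).exists_bound_of_continuousOn
      hTc.continuousOn
    have hC0 : 0 ≤ C := (norm_nonneg _).trans (hC 0 (by simp))
    have hMu0 : 0 ≤ Mu := (abs_nonneg _).trans (hMu z hz)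
    set K := (2 * Mu + C) / ρ ^ 4 with hK
    have hK0 : 0 ≤ K := by positivity
    set φ : En n × ℝ → ℝ := fun w => u z + T (w - z) + K * (‖(w - z).1‖ ^ 2 + (w - z).2 ^ 2) ^ 2 with hφ
    have hφc : ContDiff ℝ 2 φ := by
      have h1 : ContDiff ℝ 2 (fun w : En n × ℝ => (w - z).1) := by
        exact contDiff_fst.comp (contDiff_id.sub contDiff_const)
      have h2 : ContDiff ℝ 2 (fun w : En n × ℝ => (w - z).2) := by
        exact contDiff_snd.comp (contDiff_id.sub contDiff_const)
      have h3 := h1.norm_sq ℝ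
      have h4 := (H.contDiff (n := 2)).comp h1
      have h5 : ContDiff ℝ 2 (fun w : En n × ℝ => ⟪H (w - z).1, (w - z).1⟫) := h4.inner ℝ h1
      have h6 : ContDiff ℝ 2 (fun w : En n × ℝ => ⟪q, (w - z).1⟫) := contDiff_const.inner ℝ h1
      have h7 : ContDiff ℝ 2 (fun w : En n × ℝ => ⟪v, (w - z).1⟫) := contDiff_const.inner ℝ h1
      exact (contDiff_const.add (((((h6.add (contDiff_const.mul h2)).add (contDiff_const.mul h5)).add
        (h2.mul h7)).add (contDiff_const.mul (h2.pow 2))).add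
        (contDiff_const.mul (h3.add (h2.pow 2))))).add
        (contDiff_const.mul ((h3.add (h2.pow 2)).pow 2))
    have hsl : (fun y => φ (y, z.2)) = fun y => u z + ⟪q, y - z.1⟫ + 1 / 2 * ⟪H (y - z.1), y - z.1⟫
        + ε * ‖y - z.1‖ ^ 2 + K * (‖y - z.1‖ ^ 2) ^ 2 := by
      funext y
      simp only [hφ, hT, Prod.fst_sub, Prod.snd_sub, sub_self]
      ring
    have hgr : ∀ y, sGrad φ y z.2 = q + H (y - z.1) + (2 * ε) • (y - z.1)
        + (4 * K * ‖y - z.1‖ ^ 2) • (y - z.1) := by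
      intro y
      unfold sGrad gradient
      rw [hsl, (test_space H hH q z.1 (u z) ε K y).fderiv]
      rw [LinearIsometryEquiv.symm_apply_eq]
      rfl
    have hgz : sGrad φ z.1 z.2 = q := by rw [hgr]; simp
    have hhs : sHess φ z.1 z.2 = H + (2 * ε) • ContinuousLinearMap.id ℝ (En n) := by
      unfold sHess
      rw [show (fun y => sGrad φ y z.2) = _ from funext hgr]
      have hd : HasFDerivAt (fun y : En n => y - z.1) (ContinuousLinearMap.id ℝ (En n)) z.1 :=
        (hasFDerivAt_id z.1).sub_const z.1
      have h1 := (((H.hasFDerivAt.comp z.1 hd).const_add q).add (hd.const_smul (2 * ε))).add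
        ((hd.norm_sq.const_mul (4 * K)).smul hd)
      refine HasFDerivAt.fderiv (h1.congr_fderiv ?_)
      ext k
      simp
    have hdt : deriv (fun s => φ (z.1, s)) z.2 = τ := by
      have e : (fun s => φ (z.1, s)) = fun r => u z + τ * (r - z.2) + (s + ε) * (r - z.2) ^ 2
          + K * (r - z.2) ^ 4 := by
        funext r
        simp only [hφ, hT, Prod.fst_sub, Prod.snd_sub, sub_self, map_zero, inner_zero_left,
          inner_zero_right, norm_zero]
        ring
      rw [e]
      have hd : HasDerivAt (fun r : ℝ => r - z.2) 1 z.2 := (hasDerivAt_id z.2).sub_const z.2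
      have := (((hd.const_mul τ).const_add (u z)).add ((hd.pow 2).const_mul (s + ε))).add
        ((hd.pow 4).const_mul K)
      refine (this.congr_deriv ?_).deriv
      simp
    have := hs z hz φ hφc (by rw [hgz]; exact hq) (by simp [hφ, hT]) ?_
    · rwa [hgz, hhs, hdt] at this
    · intro w hw
      by_cases hc : dist (w - z) 0 < ρ
      · have h1 := hj hc
        rw [add_sub_cancel] at h1
        have h2 : 0 ≤ K * (‖(w - z).1‖ ^ 2 + (w - z).2 ^ 2) ^ 2 := by positivity
        simp only [hφ, hT]
        linarith
      · push Not at hc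
        rw [dist_zero_right] at hc
        have h1 : ‖w - z‖ ≤ 2 := by
          rw [Prod.norm_def]
          refine max_le ?_ ?_
          · have := norm_sub_le w.1 z.1
            have a1 := hw.1
            have a2 := hz.1
            simp only [Prod.fst_sub]; linarith
          · have a1 := hw.2
            have a2 := hz.2
            simp only [Prod.snd_sub, Real.norm_eq_abs, abs_le]
            constructor <;> linarith [a1.1, a1.2, a2.1, a2.2]
        have h2 := (abs_le.1 ((Real.norm_eq_abs _).symm.le.trans (hC (w - z) (by simpa using h1)))).1
        have h3 := (abs_le.1 (hMu w hw)).2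
        have h4 := (abs_le.1 (hMu z hz)).1
        have h5 : ρ ^ 2 ≤ ‖(w - z).1‖ ^ 2 + (w - z).2 ^ 2 := by
          have : ρ ^ 2 ≤ ‖w - z‖ ^ 2 := pow_le_pow_left₀ hρ.le hc 2
          rw [Prod.norm_def] at this
          rcases max_choice ‖(w - z).1‖ ‖(w - z).2‖ with h5 | h5
          · rw [h5] at this; nlinarith [sq_nonneg (w - z).2]
          · rw [h5, Real.norm_eq_abs, sq_abs] at this; nlinarith [sq_nonneg ‖(w - z).1‖]
        have h6 : (ρ ^ 2) ^ 2 ≤ (‖(w - z).1‖ ^ 2 + (w - z).2 ^ 2) ^ 2 :=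
          pow_le_pow_left₀ (by positivity) h5 2
        have h7 := mul_le_mul_of_nonneg_left h6 hK0
        have h8 : K * (ρ ^ 2) ^ 2 = 2 * Mu + C := by
          rw [hK]; field_simp
        simp only [hφ]
        linarith
  set c := ‖q‖ ^ γ * (LinearMap.trace ℝ (En n) (LinearMap.id) + (p - 2) * ⟪q, q⟫ / ‖q‖ ^ 2) with hc
  have hop : ∀ ε : ℝ, opVal γ p q (H + (2 * ε) • ContinuousLinearMap.id ℝ (En n)) =
      opVal γ p q H + 2 * ε * c := by
    intro ε
    unfold opVal
    rw [ContinuousLinearMap.toLinearMap_add, ContinuousLinearMap.toLinearMap_smul, map_add, map_smul]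
    simp only [add_apply, smul_apply, ContinuousLinearMap.id_apply, inner_add_left, inner_smul_left,
      ContinuousLinearMap.coe_id, smul_eq_mul, hc]
    simp
    ring
  apply le_of_forall_pos_le_add
  intro e he
  have := key (e / (2 * (|c| + 1))) (by positivity)
  rw [hop] at this
  have h1 : 2 * (e / (2 * (|c| + 1))) * c ≤ e := by
    have h2 : 2 * (e / (2 * (|c| + 1))) * c = e * (c / (|c| + 1)) := by
      field_simp
    rw [h2]
    have : c / (|c| + 1) ≤ 1 := by
      rw [div_le_one (by positivity)]; linarith [le_abs_self c]
    nlinarith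
  linarith

end Jets

section Frames
variable {n : ℕ}

/-- the square root of the normalized `p`-Laplacian coefficient matrix -/
def sg (c : ℝ) (q v : En n) : En n := v + (c * ⟪q, v⟫ / ‖q‖ ^ 2) • q

lemma frame_sum (b : OrthonormalBasis (Fin n) ℝ (En n)) {q : En n} (hq : q ≠ 0) {c p : ℝ}
    (hc : (1 + c) ^ 2 = p - 1) (H : En n →L[ℝ] En n) (hH : ∀ k l, ⟪H k, l⟫ = ⟪H l, k⟫) :
    ∑ i, ⟪H (sg c q (b i)), sg c q (b i)⟫ =
      LinearMap.trace ℝ (En n) H.toLinearMap + (p - 2) * ⟪H q, q⟫ / ‖q‖ ^ 2 := by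
  have hn : ‖q‖ ^ 2 ≠ 0 := by simpa using hq
  have e : ∀ i, ⟪H (sg c q (b i)), sg c q (b i)⟫ = ⟪b i, H (b i)⟫
      + (2 * c / ‖q‖ ^ 2) * (⟪q, b i⟫ * ⟪b i, H q⟫)
      + (c ^ 2 / (‖q‖ ^ 2) ^ 2 * ⟪H q, q⟫) * (⟪q, b i⟫ * ⟪b i, q⟫) := by
    intro i
    simp only [sg, map_add, map_smul, inner_add_left, inner_add_right, inner_smul_left,
      inner_smul_right, conj_trivial]
    rw [hH (b i) q, real_inner_comm (H (b i)) (b i), real_inner_comm (H q) (b i),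
      real_inner_comm q (b i)]
    field_simp
    ring
  rw [Finset.sum_congr rfl fun i _ => e i, Finset.sum_add_distrib, Finset.sum_add_distrib,
    ← Finset.mul_sum, ← Finset.mul_sum, b.sum_inner_mul_inner, b.sum_inner_mul_inner,
    LinearMap.trace_eq_sum_inner _ b, real_inner_self_eq_norm_sq, real_inner_comm (H q) q]
  have hp : p - 2 = 2 * c + c ^ 2 := by linarith
  rw [hp]
  simp only [ContinuousLinearMap.coe_coe]
  field_simp
  ring

lemma sg_smul_opVal (b : OrthonormalBasis (Fin n) ℝ (En n)) {q : En n} (hq : q ≠ 0) {c p : ℝ} (γ : ℝ)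
    (hc : (1 + c) ^ 2 = p - 1) (H : En n →L[ℝ] En n) (hH : ∀ k l, ⟪H k, l⟫ = ⟪H l, k⟫) :
    ∑ i, ⟪H (‖q‖ ^ (γ / 2) • sg c q (b i)), ‖q‖ ^ (γ / 2) • sg c q (b i)⟫ = opVal γ p q H := by
  unfold opVal
  rw [← frame_sum b hq hc H hH, Finset.mul_sum]
  refine Finset.sum_congr rfl fun i _ => ?_
  have : ‖q‖ ^ γ = ‖q‖ ^ (γ / 2) * ‖q‖ ^ (γ / 2) := by
    rw [← Real.rpow_add (norm_pos_iff.2 hq)]; ring_nf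
  rw [this]
  simp only [map_smul, inner_smul_left, inner_smul_right, conj_trivial]
  ring

/-- space-time with the Euclidean norm -/
abbrev STn (n : ℕ) : Type := WithLp 2 (En n × ℝ)

def Jn (n : ℕ) : (En n × ℝ) ≃L[ℝ] STn n := (WithLp.prodContinuousLinearEquiv 2 ℝ (En n) ℝ).symm

lemma norm_J (w : En n × ℝ) : ‖Jn n w‖ ^ 2 = ‖w.1‖ ^ 2 + w.2 ^ 2 := by
  have := WithLp.prod_norm_sq_eq_of_L2 (Jn n w)
  rw [this, Real.norm_eq_abs, sq_abs]
  rfl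

def io (k : En n) : STn n := Jn n (k, 0)
def et : STn n := Jn n (0, 1)

/-- the operator attached to a bilinear form -/
lemma exists_op (X : STn n →L[ℝ] STn n →L[ℝ] ℝ) :
    ∃ H : En n →L[ℝ] En n, ∀ k l, ⟪H k, l⟫ = X (io k) (io l) := by
  set b := EuclideanSpace.basisFun (Fin n) ℝ
  have hl : IsLinearMap ℝ (fun k : En n => ∑ i, X (io k) (io (b i)) • b i) := by
    constructor
    · intro x y
      have : io (x + y) = io x + io y := by
        unfold io; rw [← map_add]; simp
      simp only [this, map_add, add_apply, add_smul, Finset.sum_add_distrib]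
    · intro r x
      have : io (r • x) = r • io x := by
        unfold io; rw [← map_smul]; simp
      simp only [this, map_smul, smul_apply, smul_assoc, Finset.smul_sum]
  refine ⟨LinearMap.toContinuousLinearMap (hl.mk' _), fun k l => ?_⟩
  have e : io l = ∑ i, ⟪b i, l⟫ • io (b i) := by
    have h1 := b.sum_repr' l
    conv_lhs => rw [← h1]
    have : ∀ x : En n, io x = (Jn n).toContinuousLinearMap.comp (ContinuousLinearMap.inl ℝ (En n) ℝ) x :=
      fun x => rfl
    simp only [this, map_sum, map_smul]
  rw [e]
  simp only [map_sum, map_smul, LinearMap.coe_toContinuousLinearMap', IsLinearMap.mk'_apply,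
    sum_inner, inner_smul_left, conj_trivial, smul_eq_mul]
  exact Finset.sum_congr rfl fun i _ => mul_comm _ _

lemma sub_jet {γ p c : ℝ} {f u : En n × ℝ → ℝ} {Mu : ℝ} (hs : Sub1 γ p f u (pCyl n 1))
    (hc : (1 + c) ^ 2 = p - 1)
    (hMu : ∀ z ∈ pCyl n 1, |u z| ≤ Mu) (z : En n × ℝ) (hz : z ∈ pCyl n 1) {a : STn n → ℝ}
    (hau : ∀ᶠ w in nhds z, a (Jn n w) = u w) (q : En n) (hq : q ≠ 0)
    (P' : STn n →L[ℝ] ℝ) (X : STn n →L[ℝ] STn n →L[ℝ] ℝ) (hX : ∀ k l, X k l = X l k)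
    (hP : ∀ k, ⟪q, k⟫ = P' (io k))
    (jet : ∀ τ > 0, ∀ᶠ k in nhds (0 : STn n), a (Jn n z + k) ≤ a (Jn n z) + P' k + X k k / 2 + τ * ‖k‖ ^ 2)
    (b : OrthonormalBasis (Fin n) ℝ (En n)) :
    P' et ≤ f z + ∑ i, X (io (‖q‖ ^ (γ / 2) • sg c q (b i))) (io (‖q‖ ^ (γ / 2) • sg c q (b i))) := by
  obtain ⟨H, hH⟩ := exists_op X
  have hHs : ∀ k l, ⟪H k, l⟫ = ⟪H l, k⟫ := fun k l => by rw [hH, hH, hX]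
  obtain ⟨v, hv⟩ : ∃ v : En n, ∀ k, ⟪v, k⟫ = X (io k) et := by
    set ψ : En n →L[ℝ] ℝ := (X et).comp ((Jn n).toContinuousLinearMap.comp (ContinuousLinearMap.inl ℝ (En n) ℝ))
    refine ⟨(InnerProductSpace.toDual ℝ (En n)).symm ψ, fun k => ?_⟩
    rw [InnerProductSpace.toDual_symm_apply, hX]
    rfl
  have h0 := sub_jet0 hs hMu z hz q v H hHs (P' et) (X et et / 2) hq ?_
  · rw [← sg_smul_opVal b hq γ hc H hHs] at h0
    simp only [hH] at h0
    linarith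
  · intro ε hε
    have ht : Filter.Tendsto (fun κ : En n × ℝ => Jn n κ) (nhds 0) (nhds 0) :=
      (Jn n).continuous.tendsto' 0 0 (map_zero _)
    have ht2 : Filter.Tendsto (fun κ : En n × ℝ => z + κ) (nhds 0) (nhds z) := by
      have : Continuous (fun κ : En n × ℝ => z + κ) := by fun_prop
      exact this.tendsto' 0 z (add_zero z)
    filter_upwards [ht.eventually (jet ε hε), ht2.eventually hau] with κ h1 h2
    rw [← map_add, h2, hau.self_of_nhds, norm_J] at h1
    have e : Jn n κ = io κ.1 + κ.2 • et := by
      unfold io et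
      rw [← map_smul, ← map_add]; simp
    rw [e] at h1
    simp only [map_add, map_smul, add_apply, smul_apply, smul_eq_mul] at h1
    rw [hX et (io κ.1)] at h1
    rw [hP, hH, hv]
    linarith

end Frames

section Doubling
variable {n : ℕ}

/-- spatial gradient of a linear form -/
def gr (P : STn n →L[ℝ] ℝ) : En n := (InnerProductSpace.toDual ℝ (En n)).symm
  (P.comp ((Jn n).toContinuousLinearMap.comp (ContinuousLinearMap.inl ℝ (En n) ℝ)))

lemma gr_inner (P : STn n →L[ℝ] ℝ) (k : En n) : ⟪gr P, k⟫ = P (io k) := by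
  unfold gr
  rw [InnerProductSpace.toDual_symm_apply]
  rfl

lemma gr_cont : Continuous (gr (n := n)) := by
  unfold gr
  exact (InnerProductSpace.toDual ℝ (En n)).symm.continuous.comp (continuous_id.clm_comp continuous_const)

lemma io_cont : Continuous (io (n := n)) := by
  unfold io
  exact (Jn n).continuous.comp (by fun_prop)

lemma frame_contAt {P : STn n →L[ℝ] ℝ} (hP : gr P ≠ 0) (c s : ℝ) (v : En n) :
    ContinuousAt (fun P' => io (‖gr P'‖ ^ s • sg c (gr P') v)) P := by
  apply io_cont.continuousAt.comp
  have h1 : ContinuousAt (gr (n := n)) P := gr_cont.continuousAt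
  have h2 : ContinuousAt (fun P' => ‖gr P'‖ ^ s) P :=
    h1.norm.rpow_const (Or.inl (norm_ne_zero_iff.2 hP))
  refine h2.smul ?_
  unfold sg
  refine continuousAt_const.add (ContinuousAt.smul (ContinuousAt.div ?_ (h1.norm.pow 2) ?_) h1)
  · exact continuousAt_const.mul (h1.inner continuousAt_const)
  · simpa using hP

lemma sg_neg (c : ℝ) (q v : En n) : sg c (-q) v = sg c q v := by
  unfold sg
  simp [neg_div]

lemma doubling {γ p c : ℝ} {f u : En n × ℝ → ℝ} {Mu Mf : ℝ} (hv : IsViscSol γ p f u (pCyl n 1))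
    (hc : (1 + c) ^ 2 = p - 1)
    (hMu : ∀ z ∈ pCyl n 1, |u z| ≤ Mu) (hMf : ∀ z ∈ pCyl n 1, |f z| ≤ Mf) {a : STn n → ℝ} {B : ℝ}
    (ha : Continuous a) (hB : ∀ z, |a z| ≤ B) (zh wh : En n × ℝ)
    (hz : ∀ᶠ w in nhds zh, w ∈ pCyl n 1 ∧ a (Jn n w) = u w)
    (hw : ∀ᶠ w in nhds wh, w ∈ pCyl n 1 ∧ a (Jn n w) = u w)
    (P Q : STn n →L[ℝ] ℝ)
    (q : STn n × STn n →L[ℝ] STn n × STn n →L[ℝ] ℝ) (hq : ∀ x y, q x y = q y x) {ρ η : ℝ}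
    (hρ : 0 < ρ) (hη : 0 < η)
    (h : ∀ k l, ‖k‖ ≤ ρ → ‖l‖ ≤ ρ → a (Jn n zh + k) - a (Jn n wh + l) + η * (‖k‖ ^ 2 + ‖l‖ ^ 2)
      ≤ a (Jn n zh) - a (Jn n wh) + P k + Q l + q (k, l) (k, l) / 2)
    (q1 q2 : En n) (hq1 : q1 ≠ 0) (hq2 : q2 ≠ 0) (hP : ∀ k, ⟪q1, k⟫ = P (io k))
    (hQ : ∀ k, ⟪q2, k⟫ = - Q (io k)) (b1 b2 : OrthonormalBasis (Fin n) ℝ (En n)) :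
    P et + Q et ≤ 2 * Mf + ∑ i,
      q (io (‖q1‖ ^ (γ / 2) • sg c q1 (b1 i)), io (‖q2‖ ^ (γ / 2) • sg c q2 (b2 i)))
       (io (‖q1‖ ^ (γ / 2) • sg c q1 (b1 i)), io (‖q2‖ ^ (γ / 2) • sg c q2 (b2 i))) := by
  have e1 : q1 = gr P := ext_inner_right ℝ fun k => by rw [hP, gr_inner]
  have e2 : q2 = - gr Q := ext_inner_right ℝ fun k => by rw [hQ, inner_neg_left, gr_inner]
  have hg1 : gr P ≠ 0 := e1 ▸ hq1
  have hg2 : gr Q ≠ 0 := by rw [e2] at hq2; simpa using hq2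
  subst e1 e2
  simp only [norm_neg, sg_neg]
  by_contra hcon
  push Not at hcon
  set Ξ : (STn n →L[ℝ] ℝ) × (STn n →L[ℝ] ℝ) → Fin n → STn n × STn n := fun R i =>
    (io (‖gr R.1‖ ^ (γ / 2) • sg c (gr R.1) (b1 i)), io (‖gr R.2‖ ^ (γ / 2) • sg c (gr R.2) (b2 i))) with hΞ
  set F : (STn n →L[ℝ] ℝ) × (STn n →L[ℝ] ℝ) → ℝ := fun R =>
    2 * Mf + (∑ i, q (Ξ R i) (Ξ R i)) - (R.1 et + R.2 et) with hF
  have hFc : ContinuousAt F (P, Q) := by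
    refine (continuousAt_const.add (tendsto_finsetSum _ fun i _ => ?_)).sub ?_
    · have h1 : ContinuousAt (fun R => Ξ R i) (P, Q) := by
        refine ContinuousAt.prodMk ?_ ?_
        · exact ContinuousAt.comp (x := (P, Q)) (f := Prod.fst) (frame_contAt hg1 c (γ / 2) (b1 i)) continuousAt_fst
        · exact ContinuousAt.comp (x := (P, Q)) (f := Prod.snd) (frame_contAt hg2 c (γ / 2) (b2 i)) continuousAt_snd
      exact ContinuousAt.clm_apply (q.continuous.continuousAt.comp h1) h1
    · have : Continuous (fun R : (STn n →L[ℝ] ℝ) × (STn n →L[ℝ] ℝ) => R.1 et + R.2 et) := by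
        exact (continuous_fst.clm_apply continuous_const).add (continuous_snd.clm_apply continuous_const)
      exact this.continuousAt
  have hFn : ∀ᶠ R in nhds (P, Q), F R < 0 := hFc.eventually_lt_const (by simp only [hF, hΞ]; linarith)
  have hR1 : ∀ᶠ R in nhds (P, Q), gr R.1 ≠ 0 :=
    ((gr_cont.comp continuous_fst).continuousAt (x := (P, Q))).eventually_ne hg1
  have hR2 : ∀ᶠ R in nhds (P, Q), gr R.2 ≠ 0 :=
    ((gr_cont.comp continuous_snd).continuousAt (x := (P, Q))).eventually_ne hg2
  have hJ : ∀ x : En n × ℝ, Filter.Tendsto (fun y => (Jn n).symm y) (nhds (Jn n x)) (nhds x) :=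
    fun x => (Jn n).symm.continuous.tendsto' _ _ (by simp)
  obtain ⟨ε1, hε1, hh1⟩ := Metric.eventually_nhds_iff.1 (hFn.and (hR1.and hR2))
  obtain ⟨ε2, hε2, hh2⟩ := Metric.eventually_nhds_iff.1 ((hJ zh).eventually hz.eventually_nhds)
  obtain ⟨ε3, hε3, hh3⟩ := Metric.eventually_nhds_iff.1 ((hJ wh).eventually hw.eventually_nhds)
  set ε := min ε1 (min ε2 ε3) with hε
  have hε0 : 0 < ε := lt_min hε1 (lt_min hε2 hε3)
  obtain ⟨z, w, P', Q', X, Y, hz', hw', hP', hQ', hX, hY, jX, jY, hXY⟩ :=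
    ishii (a := a) (b := fun z => - a z) ha ha.neg hB (fun z => by simpa using hB z)
      (Jn n zh) (Jn n wh) P Q q hq hρ hη (fun k l hk hl => by have := h k l hk hl; linarith) hε0
  have hR := @hh1 (P', Q') (by
    rw [Prod.dist_eq]
    refine max_lt ?_ ?_
    · rw [dist_eq_norm]; exact hP'.trans_le (min_le_left _ _)
    · rw [dist_eq_norm]; exact hQ'.trans_le (min_le_left _ _))
  have hz2 := @hh2 z (by
    rw [dist_eq_norm]; exact hz'.trans_le ((min_le_right _ _).trans (min_le_left _ _)))
  have hw2 := @hh3 w (by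
    rw [dist_eq_norm]; exact hw'.trans_le ((min_le_right _ _).trans (min_le_right _ _)))
  obtain ⟨hR0, hR1, hR2⟩ := hR
  have ez : Jn n ((Jn n).symm z) = z := by simp
  have ew : Jn n ((Jn n).symm w) = w := by simp
  have k1 := sub_jet (hv.2.2.1 : Sub1 γ p f u (pCyl n 1)) hc hMu ((Jn n).symm z) hz2.self_of_nhds.1
    (a := a) (hz2.mono fun _ h => h.2) (gr P') hR1 P' X hX (gr_inner P') (by rw [ez]; exact jX) b1
  have k2 := sub_jet (sub1_neg hv.2.1) hc (Mu := Mu) (fun z hz => by simpa using hMu z hz)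
    ((Jn n).symm w) hw2.self_of_nhds.1
    (a := fun z => - a z) (hw2.mono fun _ h => by rw [h.2]) (gr Q') hR2 Q' Y hY (gr_inner Q')
    (by rw [ew]; exact jY) b2
  have f1 := (abs_le.1 (hMf _ hz2.self_of_nhds.1)).2
  have f2 := (abs_le.1 (hMf _ hw2.self_of_nhds.1)).1
  have hs := Finset.sum_le_sum fun i (_ : i ∈ Finset.univ) =>
    hXY (Ξ (P', Q') i).1 (Ξ (P', Q') i).2
  rw [Finset.sum_add_distrib] at hs
  simp only [hF, hΞ] at hR0 hs
  linarith

end Doubling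

section Coupling
variable {n : ℕ}

lemma rpow_lip (θ : ℝ) : ∃ L : ℝ, 0 ≤ L ∧ ∀ s ∈ Icc (1/2 : ℝ) (3/2), |s ^ θ - 1| ≤ L * |s - 1| := by
  have hc : ContinuousOn (fun s : ℝ => θ * s ^ (θ - 1)) (Icc (1/2 : ℝ) (3/2)) := by
    refine continuousOn_const.mul (ContinuousOn.rpow_const continuousOn_id fun x hx => Or.inl ?_)
    have := hx.1
    linarith
  obtain ⟨L, hL⟩ := isCompact_Icc.exists_bound_of_continuousOn hc
  have h1 : (1:ℝ) ∈ Icc (1/2 : ℝ) (3/2) := by constructor <;> norm_num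
  refine ⟨L, (norm_nonneg _).trans (hL 1 h1), fun s hs => ?_⟩
  have := Convex.norm_image_sub_le_of_norm_hasDerivWithin_le (f := fun s : ℝ => s ^ θ)
    (f' := fun s => θ * s ^ (θ - 1)) (s := Icc (1/2 : ℝ) (3/2)) (C := L) (x := 1) (y := s)
    (fun x hx => ((Real.hasDerivAt_rpow_const (Or.inl (by have := hx.1; linarith))).hasDerivWithinAt))
    hL (convex_Icc _ _) h1 hs
  simpa [Real.norm_eq_abs] using this

lemma rpow_bd (θ : ℝ) {s : ℝ} (hs : s ∈ Icc (1/2 : ℝ) (3/2)) : s ^ θ ≤ (1/2) ^ θ + (3/2) ^ θ := by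
  have h0 : (0:ℝ) < s := by have := hs.1; linarith
  have p1 : (0:ℝ) < (1/2) ^ θ := by positivity
  have p2 : (0:ℝ) < (3/2) ^ θ := by positivity
  rcases le_total 0 θ with h | h
  · have := Real.rpow_le_rpow h0.le hs.2 h; linarith
  · have := Real.rpow_le_rpow_of_nonpos (by norm_num) hs.1 h; linarith

lemma sum_inner_sq (b : OrthonormalBasis (Fin n) ℝ (En n)) (w : En n) :
    ∑ i, ⟪w, b i⟫ ^ 2 = ‖w‖ ^ 2 := by
  rw [← real_inner_self_eq_norm_sq, ← b.sum_inner_mul_inner w w]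
  refine Finset.sum_congr rfl fun i _ => ?_
  rw [real_inner_comm w (b i)]; ring

lemma sg_norm_le (c : ℝ) (q v : En n) : ‖sg c q v‖ ≤ (1 + |c|) * ‖v‖ := by
  unfold sg
  by_cases hq : q = 0
  · subst hq; simp; nlinarith [abs_nonneg c, norm_nonneg v]
  have hq0 : 0 < ‖q‖ := norm_pos_iff.2 hq
  have h1 := norm_add_le v ((c * ⟪q, v⟫ / ‖q‖ ^ 2) • q)
  have h2 : ‖(c * ⟪q, v⟫ / ‖q‖ ^ 2) • q‖ ≤ |c| * ‖v‖ := by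
    rw [norm_smul, Real.norm_eq_abs, abs_div, abs_mul, abs_of_nonneg (by positivity : 0 ≤ ‖q‖ ^ 2)]
    have h3 := abs_real_inner_le_norm q v
    have : |c| * |⟪q, v⟫| / ‖q‖ ^ 2 * ‖q‖ = |c| * (|⟪q, v⟫| / ‖q‖) := by field_simp
    rw [this]
    refine mul_le_mul_of_nonneg_left ?_ (abs_nonneg c)
    rw [div_le_iff₀ hq0]; linarith
  linarith

/-- reflection orthogonal to a unit vector -/
lemma exists_refl_basis (b : OrthonormalBasis (Fin n) ℝ (En n)) {e : En n} (he : ‖e‖ = 1) :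
    ∃ b2 : OrthonormalBasis (Fin n) ℝ (En n), ∀ i, b2 i = b i - (2 * ⟪e, b i⟫) • e := by
  refine ⟨b.map ((ℝ ∙ e)ᗮ.reflection), fun i => ?_⟩
  rw [OrthonormalBasis.map_apply, Submodule.reflection_orthogonal_apply]
  rw [Submodule.reflection_singleton_apply, he]
  simp only [RCLike.ofReal_real_eq_id, id, one_pow, div_one]
  rw [two_smul, mul_smul, two_smul]
  abel

set_option maxHeartbeats 2000000 in
lemma coupling (n : ℕ) (γ : ℝ) {c : ℝ} (hc : -1 < c) : ∃ C : ℝ, 0 ≤ C ∧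
    ∀ (e m : En n) (lam : ℝ), ‖e‖ = 1 → 0 < lam → ‖m‖ ≤ lam / 2 →
    ∃ b1 b2 : OrthonormalBasis (Fin n) ℝ (En n), ∀ ξ ζ : Fin n → En n,
      (∀ i, ξ i = ‖lam • e + m‖ ^ (γ / 2) • sg c (lam • e + m) (b1 i)) →
      (∀ i, ζ i = ‖lam • e‖ ^ (γ / 2) • sg c (lam • e) (b2 i)) →
      (1 + c) ^ 2 * lam ^ γ ≤ ∑ i, ⟪e, ξ i - ζ i⟫ ^ 2 ∧
      ∑ i, (‖ξ i - ζ i‖ ^ 2 - ⟪e, ξ i - ζ i⟫ ^ 2) ≤ C * (lam ^ (γ - 2) * ‖m‖ ^ 2) ∧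
      ∑ i, ‖ξ i‖ ^ 2 ≤ C * lam ^ γ := by
  obtain ⟨L, hL0, hL⟩ := rpow_lip (γ / 2)
  set D : ℝ := (1/2) ^ γ + (3/2) ^ γ with hD
  have hD0 : 0 < D := by positivity
  refine ⟨2 * n * L ^ 2 + 8 * D * c ^ 2 + n * D * (1 + |c|) ^ 2, by positivity, ?_⟩
  intro e m lam he hlam hm
  obtain ⟨b2, hb2⟩ := exists_refl_basis (EuclideanSpace.basisFun (Fin n) ℝ) he
  set b := EuclideanSpace.basisFun (Fin n) ℝ with hb
  refine ⟨b, b2, fun ξ ζ hξ hζ => ?_⟩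
  set q1 := lam • e + m with hq1
  have hle : ‖lam • e‖ = lam := by rw [norm_smul, he, mul_one, Real.norm_of_nonneg hlam.le]
  have hup : ‖q1‖ ≤ lam + ‖m‖ := by have := norm_add_le (lam • e) m; rwa [hle] at this
  have hlo : lam - ‖m‖ ≤ ‖q1‖ := by
    have h1 := norm_sub_le q1 m
    have h2 : q1 - m = lam • e := by rw [hq1]; abel
    rw [h2, hle] at h1; linarith
  set s := ‖q1‖ / lam with hs
  have hsI : s ∈ Icc (1/2 : ℝ) (3/2) := by
    constructor
    · rw [hs, le_div_iff₀ hlam]; linarith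
    · rw [hs, div_le_iff₀ hlam]; linarith
  have hq1s : ‖q1‖ = lam * s := by rw [hs]; field_simp
  have hs0 : 0 < s := by linarith [hsI.1]
  have hq10 : 0 < ‖q1‖ := by rw [hq1s]; positivity
  have hs1 : |s - 1| ≤ ‖m‖ / lam := by
    have : s - 1 = (‖q1‖ - lam) / lam := by rw [hs]; field_simp
    rw [this, abs_div, abs_of_pos hlam]
    refine div_le_div_of_nonneg_right (abs_le.2 ⟨by linarith, by linarith⟩) hlam.le
  set g1 := ‖q1‖ ^ (γ / 2) with hg1
  set g2 := lam ^ (γ / 2) with hg2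
  have hg10 : 0 < g1 := by positivity
  have hg20 : 0 < g2 := by positivity
  have hg1s : g1 = g2 * s ^ (γ / 2) := by
    rw [hg1, hq1s, Real.mul_rpow hlam.le hs0.le]
  have hgg : g2 ^ 2 = lam ^ γ := by
    rw [hg2, ← Real.rpow_natCast, ← Real.rpow_mul hlam.le]; norm_num
  have hg1sq : g1 ^ 2 ≤ D * lam ^ γ := by
    rw [hg1s, mul_pow, hgg, ← Real.rpow_natCast, ← Real.rpow_mul hs0.le]
    have := rpow_bd γ hsI
    norm_num at this ⊢
    have h0 : 0 < lam ^ γ := by positivity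
    nlinarith
  have hdiff : |g1 - g2| ≤ g2 * (L * (‖m‖ / lam)) := by
    have : g1 - g2 = g2 * (s ^ (γ / 2) - 1) := by rw [hg1s]; ring
    rw [this, abs_mul, abs_of_pos hg20]
    exact mul_le_mul_of_nonneg_left ((hL s hsI).trans (mul_le_mul_of_nonneg_left hs1 hL0)) hg20.le
  have hlg : lam ^ (γ - 2) * ‖m‖ ^ 2 = g2 ^ 2 * (‖m‖ / lam) ^ 2 := by
    rw [hgg, Real.rpow_sub hlam, Real.rpow_two]; field_simp
  have hdiff2 : (g1 - g2) ^ 2 ≤ L ^ 2 * (lam ^ (γ - 2) * ‖m‖ ^ 2) := by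
    have h1 := pow_le_pow_left₀ (abs_nonneg _) hdiff 2
    rw [sq_abs] at h1
    rw [hlg]; linarith
  have hee : ⟪e, e⟫ = 1 := by rw [real_inner_self_eq_norm_sq, he, one_pow]
  set α := ⟪q1, e⟫ with hα
  have hαle : α ^ 2 ≤ ‖q1‖ ^ 2 := by
    have := abs_real_inner_le_norm q1 e
    rw [he, mul_one] at this
    rw [← sq_abs]; exact pow_le_pow_left₀ (abs_nonneg _) this 2
  -- explicit formula for ζ
  have hζ' : ∀ i, ζ i = g2 • (b i - ((2 + c) * ⟪e, b i⟫) • e) := by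
    intro i
    rw [hζ, hle, hb2]
    congr 1
    unfold sg
    rw [hle, inner_smul_left, inner_sub_right, inner_smul_right, hee, smul_smul]
    simp only [conj_trivial]
    have : c * (lam * (⟪e, b i⟫ - 2 * ⟪e, b i⟫ * 1)) / lam ^ 2 * lam = - (c * ⟪e, b i⟫) := by
      field_simp; ring
    rw [this, add_mul, add_smul, neg_smul]
    abel
  have hξ' : ∀ i, ξ i = g1 • (b i + (c * ⟪q1, b i⟫ / ‖q1‖ ^ 2) • q1) := hξ
  -- inner products with e
  set w := (g1 + g2 * (1 + c)) • e + (g1 * (c * α / ‖q1‖ ^ 2)) • q1 with hw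
  have hinn : ∀ i, ⟪e, ξ i - ζ i⟫ = ⟪w, b i⟫ := by
    intro i
    rw [hξ', hζ', hw]
    simp only [inner_sub_right, inner_add_right, inner_smul_right, inner_add_left, inner_smul_left,
      conj_trivial, hee]
    rw [real_inner_comm q1 e]
    ring
  refine ⟨?_, ?_, ?_⟩
  · rw [Finset.sum_congr rfl fun i _ => by rw [hinn i], sum_inner_sq]
    have h1 : ⟪w, e⟫ = g1 * (1 + c * (α ^ 2 / ‖q1‖ ^ 2)) + g2 * (1 + c) := by
      rw [hw, inner_add_left, inner_smul_left, inner_smul_left, hee]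
      simp only [conj_trivial]
      rw [← hα]; ring
    have h2 : 0 ≤ α ^ 2 / ‖q1‖ ^ 2 := by positivity
    have h3 : α ^ 2 / ‖q1‖ ^ 2 ≤ 1 := by
      rw [div_le_one (by positivity)]; exact hαle
    have h4 : 0 ≤ 1 + c * (α ^ 2 / ‖q1‖ ^ 2) := by nlinarith
    have h5 : g2 * (1 + c) ≤ ⟪w, e⟫ := by
      rw [h1]; linarith [mul_nonneg hg10.le h4]
    have h6 : ⟪w, e⟫ ≤ ‖w‖ := by
      have := real_inner_le_norm w e; rwa [he, mul_one] at this
    have h7 : 0 ≤ g2 * (1 + c) := mul_nonneg hg20.le (by linarith)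
    have h8 := pow_le_pow_left₀ h7 (h5.trans h6) 2
    rw [mul_pow, hgg] at h8
    linarith
  · -- perpendicular part
    have hperp : ∀ v : En n, ‖v‖ ^ 2 - ⟪e, v⟫ ^ 2 = ‖v - ⟪e, v⟫ • e‖ ^ 2 := by
      intro v
      rw [norm_sub_sq_real, inner_smul_right, norm_smul, he, real_inner_comm e v, Real.norm_eq_abs,
        mul_one, sq_abs]
      ring
    have hterm : ∀ i, ‖ξ i - ζ i‖ ^ 2 - ⟪e, ξ i - ζ i⟫ ^ 2 ≤ 2 * (g1 - g2) ^ 2 +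
        (2 * g1 ^ 2 * c ^ 2 * ‖m‖ ^ 2 / (‖q1‖ ^ 2) ^ 2) * ⟪q1, b i⟫ ^ 2 := by
      intro i
      rw [hperp]
      have hdec : (ξ i - ζ i) - ⟪e, ξ i - ζ i⟫ • e = (g1 - g2) • (b i - ⟪e, b i⟫ • e) +
          (g1 * (c * ⟪q1, b i⟫ / ‖q1‖ ^ 2)) • (m - ⟪e, m⟫ • e) := by
        have hk : ξ i - ζ i = (g1 - g2) • b i + (g1 * (c * ⟪q1, b i⟫ / ‖q1‖ ^ 2)) • m +
          (g1 * (c * ⟪q1, b i⟫ / ‖q1‖ ^ 2) * lam + g2 * ((2 + c) * ⟪e, b i⟫)) • e := by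
          rw [hξ', hζ']
          rw [show (c * ⟪q1, b i⟫ / ‖q1‖ ^ 2) • q1 = (c * ⟪q1, b i⟫ / ‖q1‖ ^ 2) • (lam • e + m) from rfl]
          module
        rw [hk]
        simp only [inner_add_right, inner_smul_right, hee]
        module
      rw [hdec]
      have hproj : ∀ v : En n, ‖v - ⟪e, v⟫ • e‖ ^ 2 ≤ ‖v‖ ^ 2 := by
        intro v; rw [← hperp]; nlinarith [sq_nonneg ⟪e, v⟫]
      have h1 := hproj (b i)
      have h2 := hproj m
      rw [b.norm_eq_one] at h1
      have h3 : ∀ x y : En n, ‖x + y‖ ^ 2 ≤ 2 * ‖x‖ ^ 2 + 2 * ‖y‖ ^ 2 := by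
        intro x y
        have := norm_add_le x y
        nlinarith [sq_nonneg (‖x‖ - ‖y‖), norm_nonneg (x + y)]
      refine (h3 _ _).trans ?_
      rw [norm_smul, norm_smul, mul_pow, mul_pow, Real.norm_eq_abs, Real.norm_eq_abs, sq_abs, sq_abs]
      have h4 := mul_le_mul_of_nonneg_left h1 (sq_nonneg (g1 - g2))
      have h5 := mul_le_mul_of_nonneg_left h2 (sq_nonneg (g1 * (c * ⟪q1, b i⟫ / ‖q1‖ ^ 2)))
      have h6 : (2 * g1 ^ 2 * c ^ 2 * ‖m‖ ^ 2 / (‖q1‖ ^ 2) ^ 2) * ⟪q1, b i⟫ ^ 2 =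
        2 * ((g1 * (c * ⟪q1, b i⟫ / ‖q1‖ ^ 2)) ^ 2 * ‖m‖ ^ 2) := by
        field_simp
      rw [h6]
      linarith
    refine (Finset.sum_le_sum fun i _ => hterm i).trans ?_
    rw [Finset.sum_add_distrib, ← Finset.mul_sum, ← Finset.mul_sum, sum_inner_sq]
    simp only [Finset.sum_const, Finset.card_univ, Fintype.card_fin, nsmul_eq_mul]
    have h1 : 2 * g1 ^ 2 * c ^ 2 * ‖m‖ ^ 2 / (‖q1‖ ^ 2) ^ 2 * ‖q1‖ ^ 2 =
        2 * c ^ 2 * ‖m‖ ^ 2 * (g1 ^ 2 / ‖q1‖ ^ 2) := by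
      field_simp
    rw [h1]
    have h2 : g1 ^ 2 / ‖q1‖ ^ 2 ≤ 4 * D * lam ^ (γ - 2) := by
      rw [div_le_iff₀ (by positivity), Real.rpow_sub hlam, Real.rpow_two, hq1s]
      have h3 : 4 * D * (lam ^ γ / lam ^ 2) * (lam * s) ^ 2 = D * lam ^ γ * (4 * s ^ 2) := by
        field_simp
      rw [h3]
      have h4 : 1 ≤ 4 * s ^ 2 := by nlinarith [hsI.1]
      have h5 : 0 < D * lam ^ γ := by positivity
      nlinarith
    have h3 := mul_le_mul_of_nonneg_left h2 (show 0 ≤ 2 * c ^ 2 * ‖m‖ ^ 2 by positivity)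
    have h4 := mul_le_mul_of_nonneg_left hdiff2 (show (0:ℝ) ≤ 2 * n by positivity)
    have h5 : 0 ≤ n * D * (1 + |c|) ^ 2 * (lam ^ (γ - 2) * ‖m‖ ^ 2) := by positivity
    nlinarith
  · have h1 : ∀ i, ‖ξ i‖ ^ 2 ≤ D * lam ^ γ * (1 + |c|) ^ 2 := by
      intro i
      rw [hξ, norm_smul, mul_pow, Real.norm_of_nonneg hg10.le]
      have h2 := sg_norm_le c q1 (b i)
      rw [b.norm_eq_one, mul_one] at h2
      have h3 := pow_le_pow_left₀ (norm_nonneg _) h2 2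
      exact mul_le_mul hg1sq h3 (by positivity) (by positivity)
    refine (Finset.sum_le_sum fun i _ => h1 i).trans ?_
    simp only [Finset.sum_const, Finset.card_univ, Fintype.card_fin, nsmul_eq_mul]
    have h5 : 0 ≤ (2 * n * L ^ 2 + 8 * D * c ^ 2) * lam ^ γ := by positivity
    nlinarith

end Coupling

section LocalEst
variable {n : ℕ}

lemma exists_quad {F G : Type*} [NormedAddCommGroup F] [NormedSpace ℝ F]
    [NormedAddCommGroup G] [InnerProductSpace ℝ G]
    (d k1 : F →L[ℝ] En n) (e : En n) (T1 T2 : F →L[ℝ] ℝ) (N1 N2 : F →L[ℝ] G) (c1 c2 c3 c4 c5 c6 : ℝ) :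
    ∃ q : F →L[ℝ] F →L[ℝ] ℝ, (∀ x y, q x y = q y x) ∧ ∀ x, q x x =
      c1 * ⟪e, d x⟫ ^ 2 + c2 * ‖d x‖ ^ 2 + c3 * ‖k1 x‖ ^ 2 + c4 * (T1 x) ^ 2 + c5 * (T2 x) ^ 2
        + c6 * (‖N1 x‖ ^ 2 + ‖N2 x‖ ^ 2) := by
  set IE : En n →L[ℝ] En n →L[ℝ] ℝ := innerSL ℝ
  set IR : ℝ →L[ℝ] ℝ →L[ℝ] ℝ := innerSL ℝ
  set IG : G →L[ℝ] G →L[ℝ] ℝ := innerSL ℝ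
  have hIE : ∀ x y, IE x y = ⟪x, y⟫ := fun _ _ => rfl
  have hIR : ∀ x y, IR x y = ⟪x, y⟫ := fun _ _ => rfl
  have hIG : ∀ x y, IG x y = ⟪x, y⟫ := fun _ _ => rfl
  set ed : F →L[ℝ] ℝ := (innerSL ℝ e).comp d
  refine ⟨c1 • IR.bilinearComp ed ed + c2 • IE.bilinearComp d d + c3 • IE.bilinearComp k1 k1
    + c4 • IR.bilinearComp T1 T1 + c5 • IR.bilinearComp T2 T2
    + c6 • (IG.bilinearComp N1 N1 + IG.bilinearComp N2 N2), ?_, ?_⟩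
  · intro x y
    have h1 := real_inner_comm (d x) (d y)
    have h2 := real_inner_comm (k1 x) (k1 y)
    have h3 := real_inner_comm (N1 x) (N1 y)
    have h4 := real_inner_comm (N2 x) (N2 y)
    have h5 := real_inner_comm (ed x) (ed y)
    have h6 := real_inner_comm (T1 x) (T1 y)
    have h7 := real_inner_comm (T2 x) (T2 y)
    simp only [add_apply, smul_apply, ContinuousLinearMap.bilinearComp_apply, hIE, hIR, hIG, h1, h2, h3, h4, h5, h6, h7]
  · intro x
    simp only [add_apply, smul_apply, ContinuousLinearMap.bilinearComp_apply, hIE, hIR, hIG,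
      real_inner_self_eq_norm_sq, smul_eq_mul, Real.norm_eq_abs, sq_abs, ed,
      ContinuousLinearMap.comp_apply, innerSL_apply_apply]

/-- second order upper Taylor bound -/
def UT (φ : ℝ → ℝ) (r φ1 φ2 : ℝ) : Prop :=
  ∀ ε > 0, ∃ δ > 0, ∀ s, |s| < δ → φ (r + s) ≤ φ r + φ1 * s + φ2 * s ^ 2 / 2 + ε * s ^ 2

lemma radial_taylor {φ : ℝ → ℝ} {φ1 φ2 : ℝ} {D e : En n} {r : ℝ} (hr : 0 < r) (hD : D = r • e)
    (he : ‖e‖ = 1) (hφ : UT φ r φ1 φ2) {ε : ℝ} (hε : 0 < ε) :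
    ∃ δ > 0, ∀ d : En n, ‖d‖ < δ → φ ‖D + d‖ ≤ φ r + φ1 * ⟪e, d⟫ +
      (φ2 * ⟪e, d⟫ ^ 2 + φ1 / r * (‖d‖ ^ 2 - ⟪e, d⟫ ^ 2)) / 2 + ε * ‖d‖ ^ 2 := by
  obtain ⟨δ, hδ, h⟩ := hφ (ε / 2) (by positivity)
  set K := (|φ1| / (2 * r) + |φ2| / 2) / r with hK
  have hK0 : 0 ≤ K := by positivity
  refine ⟨min δ (ε / (2 * (K + 1))), lt_min hδ (by positivity), fun d hd => ?_⟩
  have hd1 : ‖d‖ < δ := hd.trans_le (min_le_left _ _)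
  have hd2 : K * ‖d‖ ≤ ε / 2 := by
    have := hd.trans_le (min_le_right _ _)
    rw [lt_div_iff₀ (by positivity)] at this
    nlinarith [norm_nonneg d]
  set s := ‖D + d‖ - r with hs
  have hDn : ‖D‖ = r := by rw [hD, norm_smul, he, mul_one, Real.norm_of_nonneg hr.le]
  have hsd : |s| ≤ ‖d‖ := by
    have := abs_norm_sub_norm_le (D + d) D
    rw [hDn, add_sub_cancel_left] at this
    exact this
  set x := ⟪e, d⟫ with hx
  have hxd : |x| ≤ ‖d‖ := by
    have := abs_real_inner_le_norm e d; rwa [he, one_mul] at this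
  have hquad : 2 * r * s + s ^ 2 = 2 * r * x + ‖d‖ ^ 2 := by
    have h1 := norm_add_sq_real D d
    rw [hDn, hD, inner_smul_left, ← hD] at h1
    have h2 : ‖D + d‖ = r + s := by rw [hs]; ring
    rw [h2] at h1
    simp only [conj_trivial] at h1
    rw [← hx] at h1
    linarith
  have h1 := h s (hsd.trans_lt hd1)
  rw [show r + s = ‖D + d‖ by rw [hs]; ring] at h1
  have hsx : s = x + (‖d‖ ^ 2 - s ^ 2) / (2 * r) := by field_simp; linarith
  have hs2 : s ^ 2 ≤ ‖d‖ ^ 2 := by rw [← sq_abs s]; exact pow_le_pow_left₀ (abs_nonneg _) hsd 2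
  have hdiff : |s ^ 2 - x ^ 2| ≤ ‖d‖ ^ 3 / r := by
    rw [show s ^ 2 - x ^ 2 = (s - x) * (s + x) by ring, abs_mul]
    have e1 : |s - x| ≤ ‖d‖ ^ 2 / (2 * r) := by
      rw [show s - x = (‖d‖ ^ 2 - s ^ 2) / (2 * r) by linarith, abs_of_nonneg (div_nonneg (by linarith) (by positivity))]
      exact div_le_div_of_nonneg_right (by nlinarith [sq_nonneg s]) (by positivity)
    have e2 : |s + x| ≤ 2 * ‖d‖ := (abs_add_le _ _).trans (by linarith)
    calc |s - x| * |s + x| ≤ ‖d‖ ^ 2 / (2 * r) * (2 * ‖d‖) :=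
          mul_le_mul e1 e2 (abs_nonneg _) (by positivity)
      _ = ‖d‖ ^ 3 / r := by field_simp
  have herr : φ1 * s + φ2 * s ^ 2 / 2 ≤ φ1 * x + (φ2 * x ^ 2 + φ1 / r * (‖d‖ ^ 2 - x ^ 2)) / 2
      + K * ‖d‖ ^ 3 := by
    have e1 : φ1 * s + φ2 * s ^ 2 / 2 = φ1 * x + (φ2 * x ^ 2 + φ1 / r * (‖d‖ ^ 2 - x ^ 2)) / 2
      + (φ2 / 2 - φ1 / (2 * r)) * (s ^ 2 - x ^ 2) := by
      have : φ1 * s = φ1 * (x + (‖d‖ ^ 2 - s ^ 2) / (2 * r)) := by rw [← hsx]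
      rw [this]; field_simp; ring
    rw [e1]
    have e2 : |φ2 / 2 - φ1 / (2 * r)| ≤ |φ1| / (2 * r) + |φ2| / 2 := by
      refine (abs_sub _ _).trans ?_
      rw [abs_div, abs_div, abs_of_pos (by positivity : 0 < 2 * r), abs_two]; linarith
    have e3 : (φ2 / 2 - φ1 / (2 * r)) * (s ^ 2 - x ^ 2) ≤ K * ‖d‖ ^ 3 := by
      refine (le_abs_self _).trans ?_
      rw [abs_mul]
      calc _ ≤ (|φ1| / (2 * r) + |φ2| / 2) * (‖d‖ ^ 3 / r) := mul_le_mul e2 hdiff (abs_nonneg _) (by positivity)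
        _ = K * ‖d‖ ^ 3 := by rw [hK]; ring
    linarith
  have e4 : K * ‖d‖ ^ 3 ≤ ε / 2 * ‖d‖ ^ 2 := by
    have := mul_le_mul_of_nonneg_right hd2 (sq_nonneg ‖d‖); linarith
  have e5 := mul_le_mul_of_nonneg_left hs2 (show 0 ≤ ε / 2 by positivity)
  linarith
end LocalEst

section LocalEst2

lemma norm_sub_sq_le2 {n : ℕ} (x y : En n) : ‖x - y‖ ^ 2 ≤ 2 * ‖x‖ ^ 2 + 2 * ‖y‖ ^ 2 := by
  have := norm_sub_le x y
  nlinarith [sq_nonneg (‖x‖ - ‖y‖), norm_nonneg (x - y)]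

lemma local_quad {n : ℕ} (Ji : STn n →L[ℝ] En n × ℝ) (e : En n) (c1 c2 c3 c4 c5 c6 : ℝ) :
    ∃ q : STn n × STn n →L[ℝ] STn n × STn n →L[ℝ] ℝ, (∀ v w, q v w = q w v) ∧
      ∀ k l, q (k, l) (k, l) = c1 * ⟪e, (Ji k).1 - (Ji l).1⟫ ^ 2 +
        c2 * ‖(Ji k).1 - (Ji l).1‖ ^ 2 + c3 * ‖(Ji k).1‖ ^ 2 + c4 * (Ji k).2 ^ 2
        + c5 * ((Ji k).2 - (Ji l).2) ^ 2 + c6 * (‖k‖ ^ 2 + ‖l‖ ^ 2) := by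
  set F1 : STn n × STn n →L[ℝ] En n := (ContinuousLinearMap.fst ℝ (En n) ℝ).comp
    (Ji.comp (ContinuousLinearMap.fst ℝ (STn n) (STn n))) with hF1
  set F2 : STn n × STn n →L[ℝ] En n := (ContinuousLinearMap.fst ℝ (En n) ℝ).comp
    (Ji.comp (ContinuousLinearMap.snd ℝ (STn n) (STn n))) with hF2
  set S1 : STn n × STn n →L[ℝ] ℝ := (ContinuousLinearMap.snd ℝ (En n) ℝ).comp
    (Ji.comp (ContinuousLinearMap.fst ℝ (STn n) (STn n))) with hS1
  set S2 : STn n × STn n →L[ℝ] ℝ := (ContinuousLinearMap.snd ℝ (En n) ℝ).comp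
    (Ji.comp (ContinuousLinearMap.snd ℝ (STn n) (STn n))) with hS2
  obtain ⟨q, hqs, hqv⟩ := exists_quad (F1 - F2) F1 e S1 (S1 - S2)
    (ContinuousLinearMap.fst ℝ (STn n) (STn n)) (ContinuousLinearMap.snd ℝ (STn n) (STn n))
    c1 c2 c3 c4 c5 c6
  exact ⟨q, hqs, fun k l => hqv (k, l)⟩

lemma local_alg {ak al axt ays L φr φd M N0 N1 ip hk ht θ tk tl t s h1 h2 φ1 φ2 r ek el Nd η Nk Nl lam : ℝ}
    (hθ : 0 < θ) (hL : 0 < L) (hlam : lam = L * φ1) (hη : 0 < η)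
    (g1 : ak - al - L * φd - M * (N0 + 2 * ip + N1) - hk - (t + tk - (s + tl)) ^ 2 / (2 * θ) ≤
      axt - ays - L * φr - M * N0 - ht - (t - s) ^ 2 / (2 * θ))
    (g3 : φd ≤ φr + φ1 * (ek - el) + (φ2 * (ek - el) ^ 2 + φ1 / r * (Nd - (ek - el) ^ 2)) / 2
      + η / (2 * L) * Nd)
    (g4 : hk ≤ ht + h1 * tk + h2 * tk ^ 2)
    (g7 : Nd ≤ 2 * (Nk + Nl)) :
    ak - al + η * (Nk + Nl) ≤ axt - ays + (lam * ek + 2 * M * ip + (h1 + (t - s) / θ) * tk) +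
      (- (lam * el) + (- ((t - s) / θ)) * tl) + ((L * φ2 - L * φ1 / r) * (ek - el) ^ 2 +
        L * φ1 / r * Nd + 2 * M * N1 + 2 * h2 * tk ^ 2
        + 1 / θ * (tk - tl) ^ 2 + 4 * η * (Nk + Nl)) / 2 := by
  subst hlam
  have g5 := mul_le_mul_of_nonneg_left g3 hL.le
  have g8 := mul_le_mul_of_nonneg_left g7 (show 0 ≤ η / 2 by positivity)
  have g12 : L * (η / (2 * L) * Nd) = η / 2 * Nd := by field_simp
  rw [mul_add, g12] at g5
  have g13 : (t + tk - (s + tl)) ^ 2 / (2 * θ) = (t - s) ^ 2 / (2 * θ) +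
    (t - s) / θ * (tk - tl) + 1 / θ * (tk - tl) ^ 2 / 2 := by
    field_simp; ring
  rw [g13] at g1
  have g14 : L * (φr + φ1 * (ek - el) + (φ2 * (ek - el) ^ 2 + φ1 / r * (Nd - (ek - el) ^ 2)) / 2)
      = L * φr + L * φ1 * ek - L * φ1 * el + ((L * φ2 - L * φ1 / r) * (ek - el) ^ 2 +
       L * φ1 / r * Nd) / 2 := by
    ring
  rw [g14] at g5
  linarith

lemma lim_eta {h A1 A2 A3 A4 Z : ℝ} (hZ0 : 0 ≤ Z)
    (main : ∀ η > 0, h ≤ A1 + (A2 + A3 + A4 + 4 * η * Z)) : h ≤ A1 + (A2 + A3 + A4) := by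
  apply le_of_forall_pos_le_add
  intro ε hε
  have := main (ε / (4 * (Z + 1))) (by positivity)
  have h3 : 4 * (ε / (4 * (Z + 1))) * Z ≤ ε := by
    have h4 : 4 * (ε / (4 * (Z + 1))) * Z = ε * (Z / (Z + 1)) := by field_simp
    have h5 : Z / (Z + 1) ≤ 1 := by rw [div_le_one (by positivity)]; linarith
    rw [h4]; have h6 := mul_le_mul_of_nonneg_left h5 hε.le; linarith
  linarith

lemma final_alg {h1 p Y L φ1 φ2 r Mf C U V W E M lam g : ℝ} (hr : 0 < r) (hL : 0 < L) (hφ1 : 0 < φ1) (hφ2 : φ2 ≤ 0)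
    (hM : 0 ≤ M) (hlam : lam = L * φ1)
    (main0 : h1 ≤ 2 * Mf + (L * φ2 * U + L * φ1 / r * V + 2 * M * W))
    (k1 : (p - 1) * Y ≤ U) (k2 : V ≤ C * (g * E)) (k3 : W ≤ C * Y) :
    h1 + (p - 1) * Y * (L * (- φ2)) ≤ 2 * Mf + C * (g * E * (lam / r) + 2 * M * Y) := by
  subst hlam
  have j1 := mul_le_mul_of_nonneg_left k1 (show 0 ≤ L * (- φ2) from mul_nonneg hL.le (by linarith))
  have j2 := mul_le_mul_of_nonneg_left k2 (show 0 ≤ L * φ1 / r by positivity)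
  have j3 := mul_le_mul_of_nonneg_left k3 (show 0 ≤ 2 * M by positivity)
  have j4 : C * (g * E * (L * φ1 / r) + 2 * M * Y) =
    L * φ1 / r * (C * (g * E)) + 2 * M * (C * Y) := by ring
  rw [j4]
  linarith

set_option maxHeartbeats 1000000 in
lemma local_est (n : ℕ) (γ : ℝ) {p : ℝ} (hp : 1 < p) : ∃ C : ℝ, 0 ≤ C ∧
    ∀ (u f : En n × ℝ → ℝ) (Mu Mf : ℝ), IsViscSol γ p f u (pCyl n 1) →
    (∀ z ∈ pCyl n 1, |u z| ≤ Mu) → (∀ z ∈ pCyl n 1, |f z| ≤ Mf) →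
    ∀ (a : STn n → ℝ) (B : ℝ), Continuous a → (∀ z, |a z| ≤ B) →
    ∀ (x y x0 e : En n) (t s r : ℝ), 0 < r → ‖e‖ = 1 → x - y = r • e →
    (∀ᶠ w in nhds (x, t), w ∈ pCyl n 1 ∧ a (Jn n w) = u w) →
    (∀ᶠ w in nhds (y, s), w ∈ pCyl n 1 ∧ a (Jn n w) = u w) →
    ∀ (φ h : ℝ → ℝ) (φ1 φ2 h1 h2 L M θ : ℝ), 0 < φ1 → φ2 ≤ 0 → 0 < L → 0 ≤ M → 0 < θ → UT φ r φ1 φ2 →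
    (∀ σ, h (t + σ) ≤ h t + h1 * σ + h2 * σ ^ 2) →
    ‖(2 * M) • (x - x0)‖ ≤ L * φ1 / 2 →
    (∀ᶠ κ in nhds (0 : (En n × ℝ) × (En n × ℝ)),
      a (Jn n ((x, t) + κ.1)) - a (Jn n ((y, s) + κ.2)) - L * φ ‖(x + κ.1.1) - (y + κ.2.1)‖
        - M * ‖x + κ.1.1 - x0‖ ^ 2 - h (t + κ.1.2) - ((t + κ.1.2) - (s + κ.2.2)) ^ 2 / (2 * θ) ≤
      a (Jn n (x, t)) - a (Jn n (y, s)) - L * φ r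
        - M * ‖x - x0‖ ^ 2 - h t - (t - s) ^ 2 / (2 * θ)) →
    h1 + (p - 1) * (L * φ1) ^ γ * (L * (- φ2)) ≤ 2 * Mf +
      C * ((L * φ1) ^ (γ - 2) * ‖(2 * M) • (x - x0)‖ ^ 2 * (L * φ1 / r) + 2 * M * (L * φ1) ^ γ) := by
  set c := √(p - 1) - 1 with hcdef
  have hc1 : -1 < c := by
    have : 0 < √(p - 1) := Real.sqrt_pos.2 (by linarith)
    linarith
  have hc : (1 + c) ^ 2 = p - 1 := by
    rw [hcdef, add_sub_cancel, Real.sq_sqrt (by linarith)]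
  obtain ⟨C, hC0, hC⟩ := coupling n γ hc1
  refine ⟨C, hC0, ?_⟩
  intro u f Mu Mf hv hMu hMf a B ha hB x y x0 e t s r hr he hxy hz hw φ h φ1 φ2 h1 h2 L M θ
    hφ1 hφ2 hL hM hθ hφ hh hm hloc
  set lam := L * φ1 with hlam
  have hlam0 : 0 < lam := by positivity
  set m := (2 * M) • (x - x0) with hmdef
  obtain ⟨b1, b2, hb⟩ := hC e m lam he hlam0 hm
  set q1 := lam • e + m with hq1
  set q2 := lam • e with hq2
  have hle : ‖q2‖ = lam := by rw [hq2, norm_smul, he, mul_one, Real.norm_of_nonneg hlam0.le]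
  have hq20 : q2 ≠ 0 := norm_pos_iff.1 (by rw [hle]; exact hlam0)
  have hq10 : q1 ≠ 0 := by
    intro h0
    have : q2 = - m := eq_neg_of_add_eq_zero_left h0
    rw [this, norm_neg] at hle
    linarith
  set ξ : Fin n → En n := fun i => ‖q1‖ ^ (γ / 2) • sg c q1 (b1 i) with hξ
  set ζ : Fin n → En n := fun i => ‖q2‖ ^ (γ / 2) • sg c q2 (b2 i) with hζ
  obtain ⟨k1, k2, k3⟩ := hb ξ ζ (fun _ => rfl) (fun _ => rfl)
  obtain ⟨Ji, hJJ, hJio, hJet⟩ : ∃ Ji : STn n →L[ℝ] En n × ℝ, (∀ k, Jn n (Ji k) = k) ∧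
      (∀ k : En n, Ji (io k) = (k, 0)) ∧ Ji (et : STn n) = (0, 1) :=
    ⟨(Jn n).symm.toContinuousLinearMap, fun k => by simp, fun k => by simp [io], by simp [et]⟩
  have hnJ : ∀ k, ‖k‖ ^ 2 = ‖(Ji k).1‖ ^ 2 + (Ji k).2 ^ 2 := fun k => by
    rw [← norm_J, hJJ]
  -- the two linear forms
  obtain ⟨P, hPa⟩ : ∃ P : STn n →L[ℝ] ℝ, ∀ k, P k = ⟪q1, (Ji k).1⟫ + (h1 + (t - s) / θ) * (Ji k).2 :=
    ⟨(innerSL ℝ q1).comp ((ContinuousLinearMap.fst ℝ (En n) ℝ).comp Ji) +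
      (h1 + (t - s) / θ) • ((ContinuousLinearMap.snd ℝ (En n) ℝ).comp Ji), fun k => rfl⟩
  obtain ⟨Q, hQa⟩ : ∃ Q : STn n →L[ℝ] ℝ, ∀ k, Q k = ⟪-q2, (Ji k).1⟫ + (- ((t - s) / θ)) * (Ji k).2 :=
    ⟨(innerSL ℝ (-q2)).comp ((ContinuousLinearMap.fst ℝ (En n) ℝ).comp Ji) +
      (- ((t - s) / θ)) • ((ContinuousLinearMap.snd ℝ (En n) ℝ).comp Ji), fun k => rfl⟩
  have main : ∀ η > 0, h1 ≤ 2 * Mf + (L * φ2 * ∑ i, ⟪e, ξ i - ζ i⟫ ^ 2 +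
      L * φ1 / r * ∑ i, (‖ξ i - ζ i‖ ^ 2 - ⟪e, ξ i - ζ i⟫ ^ 2) + 2 * M * ∑ i, ‖ξ i‖ ^ 2
      + 4 * η * ∑ i, (‖ξ i‖ ^ 2 + ‖ζ i‖ ^ 2)) := by
    intro η hη
    obtain ⟨q, hqs, hqv'⟩ := local_quad Ji e (L * φ2 - L * φ1 / r) (L * φ1 / r) (2 * M) (2 * h2) (1 / θ) (4 * η)
    obtain ⟨δ, hδ, hT⟩ := radial_taylor hr hxy he hφ (ε := η / (2 * L)) (by positivity)
    have hd : ∀ᶠ κ in nhds (0 : (En n × ℝ) × (En n × ℝ)), ‖κ.1.1 - κ.2.1‖ < δ := by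
      have : Continuous (fun κ : (En n × ℝ) × (En n × ℝ) => ‖κ.1.1 - κ.2.1‖) := by fun_prop
      exact (this.tendsto' 0 0 (by simp)).eventually_lt_const hδ
    have hpull : Filter.Tendsto (fun kl : STn n × STn n => (Ji kl.1, Ji kl.2)) (nhds 0) (nhds 0) := by
      have : Continuous (fun kl : STn n × STn n => (Ji kl.1, Ji kl.2)) :=
        (Ji.continuous.comp continuous_fst).prodMk (Ji.continuous.comp continuous_snd)
      exact this.tendsto' 0 0 (by simp)
    obtain ⟨ρ, hρ, hball⟩ := Metric.eventually_nhds_iff.1 (hpull.eventually (hloc.and hd))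
    have key := doubling hv hc hMu hMf ha hB (x, t) (y, s) hz hw P Q q hqs (ρ := ρ / 2) (by positivity) hη
      ?_ q1 q2 hq10 hq20 (fun k => by rw [hPa, hJio]; simp) (fun k => by rw [hQa, hJio]; simp) b1 b2
    · rw [hPa, hQa, hJet] at key
      simp only [inner_zero_right] at key
      have e1 : ∀ i, q (io (ξ i), io (ζ i)) (io (ξ i), io (ζ i)) = L * φ2 * ⟪e, ξ i - ζ i⟫ ^ 2 +
          L * φ1 / r * (‖ξ i - ζ i‖ ^ 2 - ⟪e, ξ i - ζ i⟫ ^ 2) + 2 * M * ‖ξ i‖ ^ 2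
          + 4 * η * (‖ξ i‖ ^ 2 + ‖ζ i‖ ^ 2) := by
        intro i
        rw [hqv', hnJ (io (ξ i)), hnJ (io (ζ i)), hJio, hJio]
        ring
      have e2 := Finset.sum_congr (rfl : (Finset.univ : Finset (Fin n)) = Finset.univ) fun i _ => e1 i
      rw [Finset.sum_add_distrib, Finset.sum_add_distrib, Finset.sum_add_distrib, ← Finset.mul_sum,
        ← Finset.mul_sum, ← Finset.mul_sum, ← Finset.mul_sum] at e2
      rw [← e2]
      have e3 : (0 + (h1 + (t - s) / θ) * 1 + (0 + -((t - s) / θ) * 1)) = h1 := by ring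
      rw [e3] at key
      exact key
    · intro k l hk hl
      have hb2 := @hball (k, l) (by
        rw [dist_zero_right, Prod.norm_def]; exact max_lt (by simp only; linarith) (by simp only; linarith))
      obtain ⟨g1, g2⟩ := hb2
      have g3 := hT ((Ji k).1 - (Ji l).1) g2
      rw [map_add, map_add, hJJ, hJJ] at g1
      rw [hqv', hPa, hQa]
      simp only at g1
      rw [show x + (Ji k).1 - (y + (Ji l).1) = x - y + ((Ji k).1 - (Ji l).1) by abel] at g1
      have g4 := hh (Ji k).2
      have g6 : ‖x + (Ji k).1 - x0‖ ^ 2 = ‖x - x0‖ ^ 2 + 2 * ⟪x - x0, (Ji k).1⟫ + ‖(Ji k).1‖ ^ 2 := by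
        rw [show x + (Ji k).1 - x0 = (x - x0) + (Ji k).1 by abel, norm_add_sq_real]
      have g7 : ‖(Ji k).1 - (Ji l).1‖ ^ 2 ≤ 2 * (‖k‖ ^ 2 + ‖l‖ ^ 2) := by
        rw [hnJ k, hnJ l]
        have h3 := norm_sub_sq_le2 (Ji k).1 (Ji l).1
        have h4 := sq_nonneg (Ji k).2
        have h5 := sq_nonneg (Ji l).2
        linarith
      rw [g6] at g1
      have g9 : ⟪q1, (Ji k).1⟫ = lam * ⟪e, (Ji k).1⟫ + 2 * M * ⟪x - x0, (Ji k).1⟫ := by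
        rw [hq1, hmdef, inner_add_left, inner_smul_left, inner_smul_left]; rfl
      have g10 : ⟪-q2, (Ji l).1⟫ = - (lam * ⟪e, (Ji l).1⟫) := by
        rw [hq2, inner_neg_left, inner_smul_left]; rfl
      rw [g9, g10]
      have g11 : ⟪e, (Ji k).1 - (Ji l).1⟫ = ⟪e, (Ji k).1⟫ - ⟪e, (Ji l).1⟫ := inner_sub_right _ _ _
      rw [g11] at g3 ⊢
      exact local_alg hθ hL hlam hη g1 g3 g4 g7
  -- let η → 0
  have main0 : h1 ≤ 2 * Mf + (L * φ2 * ∑ i, ⟪e, ξ i - ζ i⟫ ^ 2 +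
      L * φ1 / r * ∑ i, (‖ξ i - ζ i‖ ^ 2 - ⟪e, ξ i - ζ i⟫ ^ 2) + 2 * M * ∑ i, ‖ξ i‖ ^ 2) := by
    exact lim_eta (Finset.sum_nonneg fun i _ => add_nonneg (sq_nonneg _) (sq_nonneg _)) main
  rw [hc] at k1
  exact final_alg hr hL hφ1 hφ2 hM hlam main0 k1 k2 k3

end LocalEst2

section CoreMax

lemma max_quad (a σ : ℝ) : (max (a + σ) 0) ^ 2 ≤ (max a 0) ^ 2 + 2 * max a 0 * σ + σ ^ 2 := by
  have h : (max a 0) ^ 2 + 2 * max a 0 * σ + σ ^ 2 = (max a 0 + σ) ^ 2 := by ring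
  rw [h]
  rcases le_total (a + σ) 0 with h1 | h1
  · rw [max_eq_right h1, zero_pow two_ne_zero]; exact sq_nonneg _
  · rw [max_eq_left h1]
    have := le_max_left a 0
    exact pow_le_pow_left₀ h1 (by linarith) 2

set_option maxHeartbeats 1000000 in
lemma core_max {n : ℕ} {G : En n × ℝ → ℝ} {Mu κ M L t0 : ℝ} (hG : Continuous G)
    (hb : ∀ z, |G z| ≤ Mu) (hMu : 0 < Mu) (x0 y0 : En n) (hx0 : ‖x0‖ ≤ 1) (ht1 : -1 < t0) (ht0 : t0 < 0)
    (hM : 8192 * Mu ≤ M) (hL : 0 < L) {φ : ℝ → ℝ} (hφ : Continuous φ) (hφ0 : ∀ r, 0 ≤ r → r ≤ 1 / 64 → 0 ≤ φ r)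
    (hφR : 2 * Mu < L * φ (1 / 64)) (hκ : 0 < κ) (hxy : ‖x0 - y0‖ ≤ 1 / 64)
    (hk : κ ≤ G (x0, t0) - G (y0, t0) - L * φ ‖x0 - y0‖) :
    ∃ (x y : En n) (t s : ℝ) (h : ℝ → ℝ) (h1 h2 θ : ℝ), 0 < θ ∧ ‖x - x0‖ < 1 / 64 ∧ 0 < ‖x - y‖ ∧
      ‖x - y‖ < 1 / 64 ∧ t0 - 1 / 64 < t ∧ t < t0 / 2 ∧ |t - s| < 1 / 256 ∧ |t - s| < - t0 / 8 ∧
      (∀ σ, h (t + σ) ≤ h t + h1 * σ + h2 * σ ^ 2) ∧ - M / 32 ≤ h1 ∧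
      M * ‖x - x0‖ ^ 2 ≤ G (x, s) - G (y, s) ∧
      (∀ᶠ κ in nhds (0 : (En n × ℝ) × (En n × ℝ)),
      G ((x, t) + κ.1) - G ((y, s) + κ.2) - L * φ ‖(x + κ.1.1) - (y + κ.2.1)‖
        - M * ‖x + κ.1.1 - x0‖ ^ 2 - h (t + κ.1.2) - ((t + κ.1.2) - (s + κ.2.2)) ^ 2 / (2 * θ) ≤
      G (x, t) - G (y, s) - L * φ ‖x - y‖
        - M * ‖x - x0‖ ^ 2 - h t - (t - s) ^ 2 / (2 * θ)) := by
  have hM0 : 0 < M := by linarith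
  have huc : UniformContinuousOn G (Metric.closedBall 0 10) :=
    (isCompact_closedBall _ _).uniformContinuousOn_of_continuous hG.continuousOn
  obtain ⟨σ1, hσ1, hσ⟩ := Metric.uniformContinuousOn_iff.1 huc κ hκ
  set σ0 := min (min (1 / 512) (- t0 / 16)) (σ1 / 2) with hσ0
  have hσ0p : 0 < σ0 := by
    refine lt_min (lt_min (by norm_num) (by linarith)) (by linarith)
  have hs1 : σ0 ≤ 1 / 512 := (min_le_left _ _).trans (min_le_left _ _)
  have hs2 : σ0 ≤ - t0 / 16 := (min_le_left _ _).trans (min_le_right _ _)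
  have hs3 : σ0 ≤ σ1 / 2 := min_le_right _ _
  set N := 8 * Mu / t0 ^ 2 with hN
  have ht0n : t0 ≠ 0 := ht0.ne
  have ht02 : 0 < t0 ^ 2 := by positivity
  have hN0 : 0 < N := by positivity
  set θ := σ0 ^ 2 / (4 * Mu) with hθ
  have hθ0 : 0 < θ := by positivity
  set h : ℝ → ℝ := fun τ => M * (τ - t0) ^ 2 + N * (max (τ - t0) 0) ^ 2 with hh
  have hh0 : ∀ τ, 0 ≤ h τ := fun τ => by positivity
  set Ψ : (En n × ℝ) × (En n × ℝ) → ℝ := fun z => G z.1 - G z.2 - L * φ ‖z.1.1 - z.2.1‖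
    - M * ‖z.1.1 - x0‖ ^ 2 - h z.1.2 - (z.1.2 - z.2.2) ^ 2 / (2 * θ) with hΨ
  have hhc : Continuous h := by fun_prop
  have hΨc : Continuous Ψ := by fun_prop
  set K : Set ((En n × ℝ) × (En n × ℝ)) := {z | ‖z.1.1 - x0‖ ≤ 1 / 64 ∧ ‖z.1.1 - z.2.1‖ ≤ 1 / 64 ∧
    t0 - 1 / 64 ≤ z.1.2 ∧ z.1.2 ≤ t0 / 2 ∧ |z.1.2 - z.2.2| ≤ σ0} with hK
  have hKcl : IsClosed K := by
    refine IsClosed.and (isClosed_le (by fun_prop) continuous_const) ?_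
    refine IsClosed.and (isClosed_le (by fun_prop) continuous_const) ?_
    refine IsClosed.and (isClosed_le continuous_const (by fun_prop)) ?_
    refine IsClosed.and (isClosed_le (by fun_prop) continuous_const) ?_
    exact isClosed_le (by fun_prop) continuous_const
  have hKb : ∀ z ∈ K, ‖z.1.1‖ ≤ 2 ∧ ‖z.2.1‖ ≤ 2 ∧ |z.1.2| ≤ 2 ∧ |z.2.2| ≤ 2 := by
    rintro z ⟨z1, z2, z3, z4, z5⟩
    have a1 : ‖z.1.1‖ ≤ ‖z.1.1 - x0‖ + ‖x0‖ := norm_le_norm_sub_add _ _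
    have a2 : ‖z.2.1‖ ≤ ‖z.1.1‖ + ‖z.1.1 - z.2.1‖ := norm_le_norm_add_norm_sub _ _
    have a3 := abs_le.1 z5
    refine ⟨by linarith, by linarith, abs_le.2 ⟨by linarith, by linarith⟩, abs_le.2 ⟨by linarith, by linarith⟩⟩
  have hKc : IsCompact K := by
    refine (isCompact_closedBall (0 : (En n × ℝ) × (En n × ℝ)) 10).of_isClosed_subset hKcl ?_
    intro z hz
    obtain ⟨b1, b2, b3, b4⟩ := hKb z hz
    rw [mem_closedBall_zero_iff, Prod.norm_def, Prod.norm_def, Prod.norm_def]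
    simp only [sup_le_iff, Real.norm_eq_abs]
    refine ⟨⟨?_, ?_⟩, ⟨?_, ?_⟩⟩ <;> linarith
  have hmem : ((x0, t0), (y0, t0)) ∈ K := by
    refine ⟨by simp, hxy, by simp only; linarith, by simp only; linarith, ?_⟩
    simp only [sub_self, abs_zero]; exact hσ0p.le
  obtain ⟨⟨⟨x, t⟩, ⟨y, s⟩⟩, hzK, hmax⟩ := hKc.exists_isMaxOn ⟨_, hmem⟩ hΨc.continuousOn
  have hmax' : ∀ w ∈ K, Ψ w ≤ Ψ ((x, t), (y, s)) := fun w hw => hmax hw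
  have hΨ0 : κ ≤ Ψ ((x, t), (y, s)) := by
    refine le_trans ?_ (hmax' _ hmem)
    simp only [hΨ, hh]
    simp only [sub_self, norm_zero, max_self]
    norm_num
    linarith
  obtain ⟨b1, b2, b3, b4⟩ := hKb _ hzK
  obtain ⟨z1, z2, z3, z4, z5⟩ := hzK
  simp only at z1 z2 z3 z4 z5 b1 b2 b3 b4
  have hΨ1 : κ ≤ G (x, t) - G (y, s) - L * φ ‖x - y‖
    - M * ‖x - x0‖ ^ 2 - h t - (t - s) ^ 2 / (2 * θ) := hΨ0
  have p1 : 0 ≤ L * φ ‖x - y‖ := mul_nonneg hL.le (hφ0 _ (norm_nonneg _) z2)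
  have p2 : 0 ≤ M * ‖x - x0‖ ^ 2 := by positivity
  have p3 := hh0 t
  have p4 : 0 ≤ (t - s) ^ 2 / (2 * θ) := by positivity
  have hG1 := (abs_le.1 (hb (x, t))).2
  have hG2 := (abs_le.1 (hb (y, s))).1
  -- time oscillation
  have hosc : |G (x, t) - G (x, s)| < κ := by
    have mm : ∀ τ : ℝ, |τ| ≤ 2 → (x, τ) ∈ Metric.closedBall (0 : En n × ℝ) 10 := by
      intro τ hτ
      rw [mem_closedBall_zero_iff, Prod.norm_def]
      simp only [sup_le_iff, Real.norm_eq_abs]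
      exact ⟨by linarith, by linarith⟩
    have := hσ (x, t) (mm t b3) (x, s) (mm s b4) (by
      rw [Prod.dist_eq, dist_self, Real.dist_eq, max_eq_right (abs_nonneg _)]; linarith)
    rwa [Real.dist_eq] at this
  have hosc' := (abs_lt.1 hosc).2
  have c1 : ‖x - x0‖ < 1 / 64 := by
    refine lt_of_le_of_ne z1 fun h0 => ?_
    rw [h0] at p2 hΨ1
    have : M * (1 / 64) ^ 2 = M / 4096 := by ring
    linarith
  have c2 : 0 < ‖x - y‖ := by
    refine lt_of_le_of_ne (norm_nonneg _) fun h0 => ?_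
    have : x = y := by rwa [eq_comm, norm_eq_zero, sub_eq_zero] at h0
    rw [← this] at hΨ1 p1
    linarith
  have c3 : ‖x - y‖ < 1 / 64 := by
    refine lt_of_le_of_ne z2 fun h0 => ?_
    rw [h0] at hΨ1
    linarith
  have c4 : t0 - 1 / 64 < t := by
    refine lt_of_le_of_ne z3 fun h0 => ?_
    have : M * (1 / 64) ^ 2 ≤ h t := by
      simp only [hh]
      rw [← h0, show (t0 - 1 / 64 - t0) ^ 2 = (1 / 64 : ℝ) ^ 2 by ring]
      exact le_add_of_nonneg_right (by positivity)
    have : M * (1 / 64) ^ 2 = M / 4096 := by ring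
    linarith
  have c5 : t < t0 / 2 := by
    refine lt_of_le_of_ne z4 fun h0 => ?_
    have : 2 * Mu ≤ h t := by
      simp only [hh]
      rw [h0, max_eq_left (by linarith)]
      have e1 : N * (t0 / 2 - t0) ^ 2 = 2 * Mu := by
        rw [hN]; field_simp; ring
      rw [e1]
      exact le_add_of_nonneg_left (by positivity)
    linarith
  have c6 : |t - s| < σ0 := by
    refine lt_of_le_of_ne z5 fun h0 => ?_
    have e1 : (t - s) ^ 2 / (2 * θ) = 2 * Mu := by
      rw [← sq_abs, h0, hθ]; field_simp; ring
    linarith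
  refine ⟨x, y, t, s, h, 2 * M * (t - t0) + 2 * N * max (t - t0) 0, M + N, θ, hθ0, c1, c2, c3, c4, c5,
    by linarith, by linarith, ?_, ?_, ?_, ?_⟩
  · intro σ
    simp only [hh]
    have := mul_le_mul_of_nonneg_left (max_quad (t - t0) σ) hN0.le
    rw [show t + σ - t0 = t - t0 + σ by ring]
    linarith
  · have e1 : 0 ≤ 2 * N * max (t - t0) 0 := by positivity
    have e2 := mul_le_mul_of_nonneg_left c4.le hM0.le
    linarith
  · linarith
  · have hev : ∀ᶠ κ in nhds (0 : (En n × ℝ) × (En n × ℝ)), ((x, t), (y, s)) + κ ∈ K := by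
      have hin : {z : (En n × ℝ) × (En n × ℝ) | ‖z.1.1 - x0‖ < 1 / 64 ∧ ‖z.1.1 - z.2.1‖ < 1 / 64 ∧
          t0 - 1 / 64 < z.1.2 ∧ z.1.2 < t0 / 2 ∧ |z.1.2 - z.2.2| < σ0} ∈ nhds ((x, t), (y, s)) := by
        refine IsOpen.mem_nhds ?_ ⟨c1, c3, c4, c5, c6⟩
        refine IsOpen.and (isOpen_lt (by fun_prop) continuous_const) ?_
        refine IsOpen.and (isOpen_lt (by fun_prop) continuous_const) ?_
        refine IsOpen.and (isOpen_lt continuous_const (by fun_prop)) ?_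
        refine IsOpen.and (isOpen_lt (by fun_prop) continuous_const) ?_
        exact isOpen_lt (by fun_prop) continuous_const
      have ht : Filter.Tendsto (fun κ : (En n × ℝ) × (En n × ℝ) => ((x, t), (y, s)) + κ) (nhds 0)
          (nhds ((x, t), (y, s))) := by
        have : Continuous (fun κ : (En n × ℝ) × (En n × ℝ) => ((x, t), (y, s)) + κ) := by fun_prop
        exact this.tendsto' _ _ (by simp)
      filter_upwards [ht hin] with κ hκ
      exact ⟨hκ.1.le, hκ.2.1.le, hκ.2.2.1.le, hκ.2.2.2.1.le, hκ.2.2.2.2.le⟩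
    filter_upwards [hev] with κ hκ
    exact hmax' _ hκ

end CoreMax

section CoreEst

lemma tietze_clamp {X : Type*} [TopologicalSpace X] [NormalSpace X] {K : Set X} (hK : IsClosed K) {u : X → ℝ}
    {Mu : ℝ} (hMu : 0 ≤ Mu)
    (hu : ContinuousOn u K) (hb : ∀ z ∈ K, |u z| ≤ Mu) :
    ∃ G : X → ℝ, Continuous G ∧ (∀ z, |G z| ≤ Mu) ∧ ∀ z ∈ K, G z = u z := by
  obtain ⟨g, hg⟩ := ContinuousMap.exists_restrict_eq hK (⟨K.restrict u, hu.restrict⟩ : C(K, ℝ))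
  refine ⟨fun z => max (-Mu) (min Mu (g z)), by fun_prop, ?_, ?_⟩
  · intro z
    rw [abs_le]
    exact ⟨le_max_left _ _, max_le (by linarith) (min_le_left _ _)⟩
  · intro z hz
    have h1 : g z = u z := by
      have := congrArg (fun q : C(K, ℝ) => q ⟨z, hz⟩) hg
      exact this
    have h2 := abs_le.1 (hb z hz)
    simp only
    rw [h1, min_eq_right h2.2, max_eq_right h2.1]

set_option maxHeartbeats 1000000 in
lemma core_est (n : ℕ) (γ : ℝ) {p : ℝ} (hp : 1 < p) : ∃ C : ℝ, 0 ≤ C ∧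
    ∀ (u f : En n × ℝ → ℝ) (Mu Mf : ℝ), IsViscSol γ p f u (pCyl n 1) →
    (∀ z ∈ pCyl n 1, |u z| ≤ Mu) → (∀ z ∈ pCyl n 1, |f z| ≤ Mf) → 0 < Mu →
    ∀ (L M : ℝ), 8192 * Mu ≤ M → 0 < L →
    ∀ (φ φ1 φ2 : ℝ → ℝ), Continuous φ → (∀ r, 0 ≤ r → r ≤ 1 / 64 → 0 ≤ φ r) →
    (∀ r, 0 < r → r < 1 / 64 → 0 < φ1 r ∧ φ2 r ≤ 0 ∧ UT φ r (φ1 r) (φ2 r)) →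
    2 * Mu < L * φ (1 / 64) →
    ∀ (x0 y0 : En n) (t0 : ℝ), ‖x0‖ < 15 / 16 → -(225 / 256) < t0 → t0 < 0 → ‖x0 - y0‖ ≤ 1 / 64 →
    L * φ ‖x0 - y0‖ < u (x0, t0) - u (y0, t0) →
    ∃ (x y : En n) (s r d : ℝ), r = ‖x - y‖ ∧ d = ‖x - x0‖ ∧ 0 < r ∧ r < 1 / 64 ∧ d < 1 / 64 ∧
      t0 - 5 / 256 < s ∧ s < 0 ∧ M * d ^ 2 ≤ u (x, s) - u (y, s) ∧ M * d ^ 2 ≤ 2 * Mu ∧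
      (2 * M * d ≤ L * φ1 r / 2 →
        - M / 32 + (p - 1) * (L * φ1 r) ^ γ * (L * (- φ2 r)) ≤ 2 * Mf +
        C * ((L * φ1 r) ^ (γ - 2) * (2 * M * d) ^ 2 * (L * φ1 r / r) + 2 * M * (L * φ1 r) ^ γ)) := by
  obtain ⟨C, hC0, hC⟩ := local_est n γ hp
  refine ⟨C, hC0, ?_⟩
  intro u f Mu Mf hv hMu hMf hMu0 L M hM hL φ φ1 φ2 hφ hφ0 hφT hφR x0 y0 t0 hx0 ht1 ht0 hxy hlt
  have hM0 : 0 < M := by linarith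
  set K : Set (En n × ℝ) := {z | ‖z.1‖ ≤ 63 / 64 ∧ -(250 / 256) ≤ z.2 ∧ z.2 ≤ t0 / 4} with hK
  have hKcl : IsClosed K := by
    refine IsClosed.and (isClosed_le (by fun_prop) continuous_const) ?_
    refine IsClosed.and (isClosed_le continuous_const (by fun_prop)) ?_
    exact isClosed_le (by fun_prop) continuous_const
  have hKs : K ⊆ pCyl n 1 := by
    rintro z ⟨z1, z2, z3⟩
    refine ⟨by linarith, by norm_num; linarith, by linarith⟩
  obtain ⟨G, hG, hGb, hGu⟩ := tietze_clamp hKcl hMu0.le (hv.1.mono hKs) (fun z hz => hMu z (hKs hz))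
  have hy0 : ‖y0‖ ≤ ‖x0‖ + ‖x0 - y0‖ := norm_le_norm_add_norm_sub _ _
  have hG1 : G (x0, t0) = u (x0, t0) := hGu _ ⟨by simp only; linarith, by simp only; linarith, by simp only; linarith⟩
  have hG2 : G (y0, t0) = u (y0, t0) := hGu _ ⟨by simp only; linarith, by simp only; linarith, by simp only; linarith⟩
  obtain ⟨x, y, t, s, h, h1, h2, θ, hθ, c1, c2, c3, c4, c5, c6, c7, hh, hh1, hbd, hmax⟩ :=
    core_max (κ := u (x0, t0) - u (y0, t0) - L * φ ‖x0 - y0‖) hG hGb hMu0 x0 y0 (by linarith) (by linarith) ht0 hM hL hφ hφ0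
      hφR (by linarith) hxy (by rw [hG1, hG2])
  have a1 : ‖x‖ ≤ ‖x - x0‖ + ‖x0‖ := norm_le_norm_sub_add _ _
  have a2 : ‖y‖ ≤ ‖x‖ + ‖x - y‖ := norm_le_norm_add_norm_sub _ _
  have c6' := abs_lt.1 c6
  have c7' := abs_lt.1 c7
  have hev : ∀ (w : En n) (τ : ℝ), ‖w‖ < 63 / 64 → -(250 / 256) < τ → τ < t0 / 4 →
      ∀ᶠ z in nhds (w, τ), z ∈ K := by
    intro w τ g1 g2 g3
    have hin : {z : En n × ℝ | ‖z.1‖ < 63 / 64 ∧ -(250 / 256) < z.2 ∧ z.2 < t0 / 4} ∈ nhds (w, τ) := by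
      refine IsOpen.mem_nhds ?_ ⟨g1, g2, g3⟩
      refine IsOpen.and (isOpen_lt (by fun_prop) continuous_const) ?_
      refine IsOpen.and (isOpen_lt continuous_const (by fun_prop)) ?_
      exact isOpen_lt (by fun_prop) continuous_const
    filter_upwards [hin] with z hz
    exact ⟨hz.1.le, hz.2.1.le, hz.2.2.le⟩
  have hGs : ∀ w ∈ K, G w = u w := hGu
  have mx : (x, s) ∈ K := ⟨by simp only; linarith, by simp only; linarith, by simp only; linarith⟩
  have my : (y, s) ∈ K := ⟨by simp only; linarith, by simp only; linarith, by simp only; linarith⟩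
  have hbu : M * ‖x - x0‖ ^ 2 ≤ u (x, s) - u (y, s) := by rwa [hGu _ mx, hGu _ my] at hbd
  have hux := (abs_le.1 (hMu _ (hKs mx))).2
  have huy := (abs_le.1 (hMu _ (hKs my))).1
  refine ⟨x, y, s, ‖x - y‖, ‖x - x0‖, rfl, rfl, c2, c3, c1, by linarith, by linarith, hbu, by linarith, ?_⟩
  intro hm
  obtain ⟨f1, f2, f3⟩ := hφT _ c2 c3
  have hnm : ‖(2 * M) • (x - x0)‖ = 2 * M * ‖x - x0‖ := by
    rw [norm_smul, Real.norm_of_nonneg (by positivity)]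
  set a : STn n → ℝ := fun z => G ((Jn n).symm z) with ha
  have haJ : ∀ w, a (Jn n w) = G w := fun w => by simp [ha]
  have hac : Continuous a := hG.comp (Jn n).symm.continuous
  have key := hC u f Mu Mf hv hMu hMf a Mu hac (fun z => hGb _) x y x0 (‖x - y‖⁻¹ • (x - y)) t s ‖x - y‖ c2
    (by rw [norm_smul, norm_inv, norm_norm, inv_mul_cancel₀ c2.ne'])
    (by rw [smul_smul, mul_inv_cancel₀ c2.ne', one_smul])
    (by
      filter_upwards [hev x t (by linarith) (by linarith) (by linarith)] with w hw
      exact ⟨hKs hw, by rw [haJ, hGu w hw]⟩)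
    (by
      filter_upwards [hev y s (by linarith) (by linarith) (by linarith)] with w hw
      exact ⟨hKs hw, by rw [haJ, hGu w hw]⟩)
    φ h (φ1 ‖x - y‖) (φ2 ‖x - y‖) h1 h2 L M θ f1 f2 hL hM0.le hθ f3 hh (by rw [hnm]; exact hm)
    (by simp only [haJ]; exact hmax)
  rw [hnm] at key
  linarith

end CoreEst

section Finish

lemma sqrt_q {r s : ℝ} (hr : 0 < r) (hs : |s| < r) :
    s = 2 * √r * (√(r + s) - √r) + (√(r + s) - √r) ^ 2 ∧ |√(r + s) - √r| * √r ≤ |s| := by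
  have h1 := (abs_lt.1 hs).1
  have hw : 0 < √r := Real.sqrt_pos.2 hr
  have hw2 : √r ^ 2 = r := Real.sq_sqrt hr.le
  have hv : 0 ≤ √(r + s) := Real.sqrt_nonneg _
  have hv2 : √(r + s) ^ 2 = r + s := Real.sq_sqrt (by linarith)
  have e : s = (√(r + s) - √r) * (√(r + s) + √r) := by
    have : (√(r + s) - √r) * (√(r + s) + √r) = √(r + s) ^ 2 - √r ^ 2 := by ring
    rw [this, hv2, hw2]; ring
  constructor
  · rw [show 2 * √r * (√(r + s) - √r) + (√(r + s) - √r) ^ 2 = (√(r + s) - √r) * (√(r + s) + √r) by ring]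
    exact e
  · have e2 : |s| = |√(r + s) - √r| * (√(r + s) + √r) := by
      conv_lhs => rw [e]
      rw [abs_mul, abs_of_nonneg (show 0 ≤ √(r + s) + √r by linarith)]
    rw [e2]
    exact mul_le_mul_of_nonneg_left (by linarith) (abs_nonneg _)

lemma cube_bound {w q s r ε : ℝ} (hw : 0 < w) (hr : w ^ 2 = r) (hs : |s| < r) (hq : |q| * w ≤ |s|)
    (hε : |s| ≤ ε * w ^ 3) :
    |q| ^ 3 ≤ ε * s ^ 2 ∧ q ^ 4 ≤ w * |q| ^ 3 := by
  have hqw : |q| ≤ w := by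
    have : |q| * w ≤ w * w := by rw [← sq, hr]; linarith
    exact le_of_mul_le_mul_right this hw
  constructor
  · have h1 : (|q| * w) ^ 3 ≤ |s| ^ 3 := pow_le_pow_left₀ (by positivity) hq 3
    have h2 : |s| ^ 3 = |s| * s ^ 2 := by rw [← sq_abs s]; ring
    have h3 : |s| * s ^ 2 ≤ ε * w ^ 3 * s ^ 2 := mul_le_mul_of_nonneg_right hε (sq_nonneg _)
    have h4 : |q| ^ 3 * w ^ 3 ≤ ε * s ^ 2 * w ^ 3 := by
      calc |q| ^ 3 * w ^ 3 = (|q| * w) ^ 3 := by ring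
        _ ≤ _ := h1
        _ = _ := h2
        _ ≤ _ := h3
        _ = _ := by ring
    exact le_of_mul_le_mul_right h4 (by positivity)
  · have h1 : q ^ 4 = |q| * |q| ^ 3 := by
      have : |q| * |q| ^ 3 = (|q| ^ 2) ^ 2 := by ring
      rw [this, sq_abs]; ring
    rw [h1]
    exact mul_le_mul_of_nonneg_right hqw (by positivity)

lemma UT_sqrt {r : ℝ} (hr : 0 < r) : UT (fun x => √x) r (1 / (2 * √r)) (-(1 / (4 * √r ^ 3))) := by
  intro ε hε
  have hw : 0 < √r := Real.sqrt_pos.2 hr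
  have hw2 : √r ^ 2 = r := Real.sq_sqrt hr.le
  refine ⟨min r (ε * √r ^ 2 * √r ^ 3), lt_min hr (by positivity), fun s hs => ?_⟩
  have hs1 := hs.trans_le (min_le_left _ _)
  have hs2 := hs.trans_le (min_le_right _ _)
  obtain ⟨q1, q2⟩ := sqrt_q hr hs1
  simp only
  set w := √r with hwd
  set q := √(r + s) - w with hq
  obtain ⟨b1, b2⟩ := cube_bound hw hw2 hs1 q2 hs2.le
  have hv : √(r + s) = w + q := by rw [hq]; ring
  rw [hv]
  have id1 : w + q = w + 1 / (2 * w) * s + -(1 / (4 * w ^ 3)) * s ^ 2 / 2 + (4 * w * q ^ 3 + q ^ 4) / (8 * w ^ 3) := by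
    rw [q1]; field_simp; ring
  have e1 : (4 * w * q ^ 3 + q ^ 4) / (8 * w ^ 3) ≤ ε * s ^ 2 := by
    rw [div_le_iff₀ (by positivity)]
    have e2 : q ^ 3 ≤ |q| ^ 3 := by rw [← abs_pow]; exact le_abs_self _
    have e3 := mul_le_mul_of_nonneg_left e2 hw.le
    have e4 := mul_le_mul_of_nonneg_left b1 hw.le
    have e5 : 0 ≤ ε * w ^ 3 * s ^ 2 := by positivity
    linarith
  linarith

lemma UT_32 {r : ℝ} (hr : 0 < r) : UT (fun x => x - x * √x) r (1 - 3 / 2 * √r) (-(3 / (4 * √r))) := by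
  intro ε hε
  have hw : 0 < √r := Real.sqrt_pos.2 hr
  have hw2 : √r ^ 2 = r := Real.sq_sqrt hr.le
  refine ⟨min r (ε * √r ^ 3), lt_min hr (by positivity), fun s hs => ?_⟩
  have hs1 := hs.trans_le (min_le_left _ _)
  have hs2 := hs.trans_le (min_le_right _ _)
  obtain ⟨q1, q2⟩ := sqrt_q hr hs1
  simp only
  set w := √r with hwd
  set q := √(r + s) - w with hq
  obtain ⟨b1, b2⟩ := cube_bound hw hw2 hs1 q2 hs2.le
  have hv : √(r + s) = w + q := by rw [hq]; ring
  rw [hv]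
  have id1 : r + s - (r + s) * (w + q) = r - r * w + (1 - 3 / 2 * w) * s + -(3 / (4 * w)) * s ^ 2 / 2
      + (4 * w * q ^ 3 + 3 * q ^ 4) / (8 * w) := by
    rw [q1, ← hw2]; field_simp; ring
  have e1 : (4 * w * q ^ 3 + 3 * q ^ 4) / (8 * w) ≤ ε * s ^ 2 := by
    rw [div_le_iff₀ (by positivity)]
    have e2 : q ^ 3 ≤ |q| ^ 3 := by rw [← abs_pow]; exact le_abs_self _
    have e3 := mul_le_mul_of_nonneg_left e2 hw.le
    have e4 := mul_le_mul_of_nonneg_left b1 hw.le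
    have e5 : 0 ≤ ε * w * s ^ 2 := by positivity
    linarith
  linarith

lemma contra {γ p : ℝ} (hγ : -1 < γ) (hp : 1 < p) (C D A1 : ℝ) : ∃ A, 1024 ≤ A ∧ A1 ≤ A ∧ (0 ≤ C → 0 ≤ D →
    ∀ (S Mu Mf lam m r k E : ℝ), 0 < S → Mu ≤ S → Mu ≤ S ^ (1 + γ) → Mf ≤ S ^ (1 + γ) →
    A * S / 2 ≤ lam → 1 / 2 ≤ k → 0 < r → m ^ 2 ≤ D * S ^ 2 * (r * k) → lam * k ≤ E →
    - (8192 * Mu) / 32 + (p - 1) * lam ^ γ * E ≤ 2 * Mf +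
        C * (lam ^ (γ - 2) * m ^ 2 * (lam / r) + 2 * (8192 * Mu) * lam ^ γ) → False) := by
  have hT : Filter.Tendsto (fun A : ℝ => 516 * (2 / A) ^ (1 + γ) + C * (4 * D / A ^ 2 + 65536 / A))
      Filter.atTop (nhds (516 * 0 + C * (0 + 0))) := by
    have t1 : Filter.Tendsto (fun A : ℝ => (2 / A)) Filter.atTop (nhds 0) :=
      Filter.Tendsto.const_div_atTop Filter.tendsto_id 2
    have t2 : Filter.Tendsto (fun A : ℝ => (2 / A) ^ (1 + γ)) Filter.atTop (nhds 0) := by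
      have := t1.rpow_const (p := 1 + γ) (Or.inr (by linarith))
      rwa [Real.zero_rpow (by linarith)] at this
    have t3 : Filter.Tendsto (fun A : ℝ => 4 * D / A ^ 2) Filter.atTop (nhds 0) :=
      Filter.Tendsto.const_div_atTop (Filter.tendsto_pow_atTop two_ne_zero) _
    have t4 : Filter.Tendsto (fun A : ℝ => (65536 / A)) Filter.atTop (nhds 0) :=
      Filter.Tendsto.const_div_atTop Filter.tendsto_id _
    exact (t2.const_mul _).add ((t3.add t4).const_mul _)
  have hE := hT.eventually_lt_const (show 516 * 0 + C * (0 + 0) < p - 1 by linarith)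
  obtain ⟨A, hA, hA1, hA2⟩ := (hE.and ((Filter.eventually_ge_atTop 1024).and (Filter.eventually_ge_atTop A1))).exists
  refine ⟨A, hA1, hA2, ?_⟩
  intro hC hD S Mu Mf lam m r k E hS hMS hMS' hMf hlam hk hr hm hEk hineq
  have hA0 : 0 < A := by linarith
  have hl : 0 < lam := lt_of_lt_of_le (by positivity) hlam
  have hk0 : 0 < k := by linarith
  set Y := lam ^ γ with hY
  have hY0 : 0 < Y := Real.rpow_pos_of_pos hl _
  have hY2 : lam ^ (γ - 2) = Y / lam ^ 2 := by
    rw [Real.rpow_sub hl, Real.rpow_two]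
  have hSl : S ≤ 2 / A * lam := by
    rw [div_mul_eq_mul_div, le_div_iff₀ hA0]; linarith
  set b := (2 / A) ^ (1 + γ) with hb
  have hSp : S ^ (1 + γ) ≤ b * (Y * lam) := by
    calc S ^ (1 + γ) ≤ (2 / A * lam) ^ (1 + γ) := Real.rpow_le_rpow hS.le hSl (by linarith)
      _ = b * lam ^ (1 + γ) := Real.mul_rpow (by positivity) hl.le
      _ = _ := by rw [Real.rpow_add hl, Real.rpow_one]; ring
  have hS2 : S ^ 2 ≤ 4 / A ^ 2 * lam ^ 2 := by
    calc S ^ 2 ≤ (2 / A * lam) ^ 2 := pow_le_pow_left₀ hS.le hSl 2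
      _ = _ := by ring
  have hm2 : m ^ 2 / (lam * r) ≤ 4 * D / A ^ 2 * (lam * k) := by
    rw [div_le_iff₀ (by positivity)]
    calc m ^ 2 ≤ D * S ^ 2 * (r * k) := hm
      _ ≤ D * (4 / A ^ 2 * lam ^ 2) * (r * k) := by gcongr
      _ = _ := by ring
  have i1 : lam ^ (γ - 2) * m ^ 2 * (lam / r) = Y * (m ^ 2 / (lam * r)) := by
    rw [hY2]; field_simp
  rw [i1] at hineq
  have i2 : (p - 1) * Y * (lam * k) ≤ (p - 1) * Y * E :=
    mul_le_mul_of_nonneg_left hEk (mul_nonneg (by linarith) hY0.le)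
  have i3 : C * (Y * (m ^ 2 / (lam * r)) + 2 * (8192 * Mu) * Y) ≤
      C * (Y * (4 * D / A ^ 2 * (lam * k)) + 2 * (8192 * (2 / A * lam)) * Y) := by
    have : Mu ≤ 2 / A * lam := hMS.trans hSl
    gcongr
  have hb0 : 0 < b := Real.rpow_pos_of_pos (by positivity) _
  -- divide by Y * lam
  have i4 : (p - 1) * k * (Y * lam) ≤ (516 * b + C * (4 * D / A ^ 2 + 65536 / A)) * k * (Y * lam) := by
    have j1 : 258 * (b * (Y * lam)) ≤ 516 * b * k * (Y * lam) := by
      have : 0 ≤ (k - 1 / 2) * (516 * (b * (Y * lam))) := mul_nonneg (by linarith) (by positivity)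
      linarith
    have j2 : C * (2 * (8192 * (2 / A * lam)) * Y) ≤ C * (65536 / A) * k * (Y * lam) := by
      have h1 : 0 ≤ (k - 1 / 2) * (C * (65536 / A) * (Y * lam)) := mul_nonneg (by linarith) (by positivity)
      have h2 : C * (2 * (8192 * (2 / A * lam)) * Y) = 1 / 2 * (C * (65536 / A) * (Y * lam)) := by ring
      linarith
    linarith
  have i5 := le_of_mul_le_mul_right i4 (by positivity)
  have i6 := le_of_mul_le_mul_right i5 hk0
  linarith

end Finish

section Finish2

lemma sqrt_64 : √(1 / 64 : ℝ) = 1 / 8 := by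
  rw [show (1 / 64 : ℝ) = (1 / 8) ^ 2 by norm_num, Real.sqrt_sq (by norm_num)]

lemma holder_est (n : ℕ) {γ p : ℝ} (hγ : -1 < γ) (hp : 1 < p) : ∃ A : ℝ, 0 < A ∧
    ∀ (u f : En n × ℝ → ℝ) (Mu Mf S : ℝ), IsViscSol γ p f u (pCyl n 1) →
    (∀ z ∈ pCyl n 1, |u z| ≤ Mu) → (∀ z ∈ pCyl n 1, |f z| ≤ Mf) → 0 < Mu →
    Mu ≤ S → Mu ≤ S ^ (1 + γ) → Mf ≤ S ^ (1 + γ) →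
    ∀ (x0 y0 : En n) (t0 : ℝ), ‖x0‖ < 15 / 16 → -(225 / 256) < t0 → t0 < 0 → ‖x0 - y0‖ ≤ 1 / 64 →
    u (x0, t0) - u (y0, t0) ≤ A * S * √‖x0 - y0‖ := by
  obtain ⟨C, hC0, hC⟩ := core_est n γ hp
  obtain ⟨A, hA, -, hcon⟩ := contra hγ hp C 131072 0
  refine ⟨A, by linarith, ?_⟩
  intro u f Mu Mf S hv hMu hMf hMu0 hS1 hS2 hS3 x0 y0 t0 hx0 ht1 ht0 hxy
  by_contra hlt
  push Not at hlt
  have hS : 0 < S := by linarith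
  have hAS : 1024 * S ≤ A * S := mul_le_mul_of_nonneg_right hA hS.le
  obtain ⟨x, y, s, r, d, hr, hd, hr0, hr1, hd1, hs1, hs2, hb1, hb2, hin⟩ :=
    hC u f Mu Mf hv hMu hMf hMu0 (A * S) (8192 * Mu) le_rfl (by linarith) (fun x => √x)
      (fun r => 1 / (2 * √r)) (fun r => -(1 / (4 * √r ^ 3))) Real.continuous_sqrt (fun r _ _ => Real.sqrt_nonneg _)
      (fun r h0 _ => ⟨by positivity, by
        have : 0 ≤ 1 / (4 * √r ^ 3) := by positivity
        linarith, UT_sqrt h0⟩)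
      (by rw [sqrt_64]; linarith) x0 y0 t0 hx0 ht1 ht0 hxy hlt
  have hw : 0 < √r := Real.sqrt_pos.2 hr0
  have hw2 : √r ^ 2 = r := Real.sq_sqrt hr0.le
  have hw8 : √r < 1 / 8 := by
    rw [← sqrt_64]; exact Real.sqrt_lt_sqrt hr0.le hr1
  set w := √r with hwd
  have hd0 : 0 ≤ d := by rw [hd]; exact norm_nonneg _
  have hm1 : 2 * (8192 * Mu) * d ≤ 256 * S := by
    have h1 := mul_le_mul_of_nonneg_left hd1.le (show 0 ≤ 2 * (8192 * Mu) by positivity)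
    linarith
  have hlam : 4 * (A * S) ≤ A * S * (1 / (2 * w)) := by
    have : 4 ≤ 1 / (2 * w) := by rw [le_div_iff₀ (by positivity)]; linarith
    have := mul_le_mul_of_nonneg_left this (show 0 ≤ A * S by linarith)
    linarith
  refine hcon hC0 (by norm_num) S Mu Mf (A * S * (1 / (2 * w))) (2 * (8192 * Mu) * d) r (1 / (2 * r))
    (A * S * - -(1 / (4 * w ^ 3))) hS hS1 hS2 hS3 (by linarith) ?_ hr0 ?_ ?_ (hin (by linarith))
  · rw [le_div_iff₀ (by positivity)]; linarith
  · have h1 : (2 * (8192 * Mu) * d) ^ 2 ≤ (256 * S) ^ 2 := pow_le_pow_left₀ (by positivity) hm1 2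
    have h2 : r * (1 / (2 * r)) = 1 / 2 := by field_simp
    rw [h2]
    linarith
  · apply le_of_eq
    rw [← hw2]; field_simp; norm_num

lemma lip_est (n : ℕ) {γ p : ℝ} (hγ : -1 < γ) (hp : 1 < p) : ∃ A : ℝ, 128 ≤ A ∧
    ∀ (u f : En n × ℝ → ℝ) (Mu Mf S : ℝ), IsViscSol γ p f u (pCyl n 1) →
    (∀ z ∈ pCyl n 1, |u z| ≤ Mu) → (∀ z ∈ pCyl n 1, |f z| ≤ Mf) → 0 < Mu →
    Mu ≤ S → Mu ≤ S ^ (1 + γ) → Mf ≤ S ^ (1 + γ) →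
    ∀ (x0 y0 : En n) (t0 : ℝ), ‖x0‖ < 7 / 8 → -(49 / 64) < t0 → t0 < 0 → ‖x0 - y0‖ ≤ 1 / 64 →
    u (x0, t0) - u (y0, t0) ≤ A * S * ‖x0 - y0‖ := by
  obtain ⟨A1, hA1, hH⟩ := holder_est n hγ hp
  obtain ⟨C, hC0, hC⟩ := core_est n γ hp
  obtain ⟨A, hA, -, hcon⟩ := contra hγ hp C (65536 * A1) 0
  refine ⟨A, by linarith, ?_⟩
  intro u f Mu Mf S hv hMu hMf hMu0 hS1 hS2 hS3 x0 y0 t0 hx0 ht1 ht0 hxy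
  by_contra hlt
  push Not at hlt
  have hS : 0 < S := by linarith
  have hAS : 1024 * S ≤ A * S := mul_le_mul_of_nonneg_right hA hS.le
  have hAS0 : 0 < A * S := by linarith
  have hw18 : ∀ r : ℝ, r ≤ 1 / 64 → √r ≤ 1 / 8 := fun r h => by
    rw [← sqrt_64]; exact Real.sqrt_le_sqrt h
  have hlt' : A * S * (‖x0 - y0‖ - ‖x0 - y0‖ * √‖x0 - y0‖) < u (x0, t0) - u (y0, t0) := by
    refine lt_of_le_of_lt (mul_le_mul_of_nonneg_left ?_ hAS0.le) hlt
    have : 0 ≤ ‖x0 - y0‖ * √‖x0 - y0‖ := by positivity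
    linarith
  obtain ⟨x, y, s, r, d, hr, hd, hr0, hr1, hd1, hs1, hs2, hb1, hb2, hin⟩ :=
    hC u f Mu Mf hv hMu hMf hMu0 (A * S) (8192 * Mu) le_rfl (by linarith) (fun x => x - x * √x)
      (fun r => 1 - 3 / 2 * √r) (fun r => -(3 / (4 * √r))) (by fun_prop)
      (fun r h0 h1 => by
        have := mul_le_mul_of_nonneg_left (hw18 r h1) h0
        linarith)
      (fun r h0 h1 => ⟨by have := hw18 r h1.le; linarith, by
        have : 0 ≤ 3 / (4 * √r) := by positivity
        linarith, UT_32 h0⟩)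
      (by simp only [sqrt_64]; linarith) x0 y0 t0 (by linarith) (by linarith) ht0 hxy hlt'
  have a1 : ‖x‖ ≤ ‖x - x0‖ + ‖x0‖ := norm_le_norm_sub_add _ _
  have hh := hH u f Mu Mf S hv hMu hMf hMu0 hS1 hS2 hS3 x y s (by linarith) (by linarith) hs2 (by linarith)
  rw [← hr] at hh
  have hw : 0 < √r := Real.sqrt_pos.2 hr0
  have hw2 : √r ^ 2 = r := Real.sq_sqrt hr0.le
  have hw8 : √r ≤ 1 / 8 := hw18 r hr1.le
  set w := √r with hwd
  have hd0 : 0 ≤ d := by rw [hd]; exact norm_nonneg _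
  have hm1 : 2 * (8192 * Mu) * d ≤ 256 * S := by
    have h1 := mul_le_mul_of_nonneg_left hd1.le (show 0 ≤ 2 * (8192 * Mu) by positivity)
    linarith
  have hlam : A * S / 2 ≤ A * S * (1 - 3 / 2 * w) := by
    have : 1 / 2 ≤ 1 - 3 / 2 * w := by linarith
    have := mul_le_mul_of_nonneg_left this hAS0.le
    linarith
  refine hcon hC0 (by positivity) S Mu Mf (A * S * (1 - 3 / 2 * w)) (2 * (8192 * Mu) * d) r (3 / (4 * w))
    (A * S * - -(3 / (4 * w))) hS hS1 hS2 hS3 hlam ?_ hr0 ?_ ?_ (hin (by linarith))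
  · rw [le_div_iff₀ (by positivity)]; linarith
  · have h1 : 8192 * Mu * d ^ 2 ≤ A1 * S * w := hb1.trans hh
    have h2 : (2 * (8192 * Mu) * d) ^ 2 = 32768 * Mu * (8192 * Mu * d ^ 2) := by ring
    have h3 : r * (3 / (4 * w)) = 3 / 4 * w := by rw [← hw2]; field_simp
    rw [h2, h3]
    have h4 : 32768 * Mu * (8192 * Mu * d ^ 2) ≤ 32768 * S * (A1 * S * w) := by gcongr
    have h5 : 0 ≤ A1 * S ^ 2 * w := by positivity
    linarith
  · rw [neg_neg]
    refine mul_le_mul_of_nonneg_right ?_ (by positivity)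
    have := mul_le_mul_of_nonneg_left hw.le hAS0.le
    linarith

end Finish2

/-- **Lemma 2.2 (Lipschitz estimate).** For `-1 < γ < ∞`, `1 < p < ∞`, `f ∈ C(Q₁) ∩ L^∞(Q₁)`
and `u` a bounded viscosity solution of `∂ₜ u - |Du|^γ Δ_p^N u = f` in `Q₁`, there is
`C = C(p,n,γ) > 0` such that for all `(x,t), (y,t) ∈ Q_{7/8}`,
`|u(x,t) - u(y,t)| ≤ C (‖u‖_∞ + ‖u‖_∞^{1/(1+γ)} + ‖f‖_∞^{1/(1+γ)}) |x - y|`. -/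
theorem lipschitz_estimate
    (n : ℕ) (hn : 1 ≤ n) (γ p : ℝ) (hγ : -1 < γ) (hp : 1 < p) :
    ∃ C : ℝ, 0 < C ∧
      ∀ (u f : En n × ℝ → ℝ) (Mu Mf : ℝ),
        ContinuousOn f (pCyl n 1) →
        (∀ z ∈ pCyl n 1, |f z| ≤ Mf) →
        (∀ z ∈ pCyl n 1, |u z| ≤ Mu) →
        IsViscSol γ p f u (pCyl n 1) →
        ∀ (x y : En n) (t : ℝ), (x, t) ∈ pCyl n (7/8) → (y, t) ∈ pCyl n (7/8) →
          |u (x, t) - u (y, t)| ≤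
            C * (Mu + Mu ^ (1 / (1 + γ)) + Mf ^ (1 / (1 + γ))) * ‖x - y‖ := by
  obtain ⟨A, hA, hL⟩ := lip_est n hγ hp
  refine ⟨A, by linarith, ?_⟩
  intro u f Mu Mf _ hMf hMu hv x y t hx hy
  obtain ⟨hx1, hx2, hx3⟩ := hx
  obtain ⟨hy1, hy2, hy3⟩ := hy
  simp only at hx1 hx2 hx3 hy1
  have hx2' : -(49 / 64) < t := by norm_num at hx2; linarith
  have hxQ : (x, t) ∈ pCyl n 1 := ⟨by simp only; linarith, by norm_num; linarith, hx3⟩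
  have hyQ : (y, t) ∈ pCyl n 1 := ⟨by simp only; linarith, by norm_num; linarith, hx3⟩
  have hMf0 : 0 ≤ Mf := (abs_nonneg _).trans (hMf _ hxQ)
  have hMu0 : 0 ≤ Mu := (abs_nonneg _).trans (hMu _ hxQ)
  have hg : 0 < 1 + γ := by linarith
  set S := Mu + Mu ^ (1 / (1 + γ)) + Mf ^ (1 / (1 + γ)) with hS
  have p1 : 0 ≤ Mu ^ (1 / (1 + γ)) := Real.rpow_nonneg hMu0 _
  have p2 : 0 ≤ Mf ^ (1 / (1 + γ)) := Real.rpow_nonneg hMf0 _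
  have hS1 : Mu ≤ S := by linarith
  have hpow : ∀ m : ℝ, 0 ≤ m → m ^ (1 / (1 + γ)) ≤ S → m ≤ S ^ (1 + γ) := by
    intro m hm h
    have := Real.rpow_le_rpow (Real.rpow_nonneg hm _) h hg.le
    rwa [← Real.rpow_mul hm, one_div_mul_cancel hg.ne', Real.rpow_one] at this
  have hS2 := hpow Mu hMu0 (by linarith)
  have hS3 := hpow Mf hMf0 (by linarith)
  have hS0 : 0 ≤ S := by linarith
  have bx := abs_le.1 (hMu _ hxQ)
  have hyb := abs_le.1 (hMu _ hyQ)
  rcases hMu0.eq_or_lt with h0 | hpos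
  · have : 0 ≤ A * S * ‖x - y‖ := by positivity
    rw [abs_le]
    constructor <;> linarith
  · rcases le_total ‖x - y‖ (1 / 64) with hle | hge
    · have k1 := hL u f Mu Mf S hv hMu hMf hpos hS1 hS2 hS3 x y t hx1 hx2' hx3 hle
      have k2 := hL u f Mu Mf S hv hMu hMf hpos hS1 hS2 hS3 y x t hy1 hx2' hx3 (by rwa [norm_sub_rev])
      rw [norm_sub_rev y x] at k2
      rw [abs_le]
      constructor <;> linarith
    · have k1 : 128 * S ≤ A * S := mul_le_mul_of_nonneg_right hA hS0
      have k2 : A * S * (1 / 64) ≤ A * S * ‖x - y‖ := mul_le_mul_of_nonneg_left hge (by linarith)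
      rw [abs_le]
      constructor <;> linarith
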